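/- arXiv:1904.10385 — 3 statements merged into one kernel-verified Lean document; each statement's English description precedes it below -/
import Mathlib

section
/- If L ∘ T₀(t) is a compact operator for every t > 0, then S₂ is norm continuous and compact on (0,∞), and L ∘ R₀(t) is compact for every t > 0; consequently, there exists t₀ ≥ 0 such that T₀ is norm continuous on (t₀,∞) if and only if there exists t₁ ≥ 0 such that R₀ is norm continuous on (t₁,∞), and there exists t₀ ≥ 0 such that T₀(t) is compact for all t > t₀ if and only if there exists t₁ ≥ 0 such that R₀(t) is compact for all t > t₁. -/
open Set Filter MeasureTheory
open scoped Topology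

noncomputable section

structure MRSetting (X : Type*) [NormedAddCommGroup X] [NormedSpace ℂ X] [CompleteSpace X]
    (X₀ : Submodule ℂ X) where
  closed : IsClosed (X₀ : Set X)
  T : ℝ → (X₀ →L[ℂ] X₀)
  S : ℝ → (X →L[ℂ] X₀)
  T_zero : T 0 = 1
  T_add : ∀ t s : ℝ, 0 ≤ t → 0 ≤ s → T (t + s) = (T t).comp (T s)
  T_cont : ∀ x : X₀, ContinuousOn (fun t => T t x) (Ici 0)
  S_zero : S 0 = 0
  S_cont : ∀ x : X, ContinuousOn (fun t => S t x) (Ici 0)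
  TS : ∀ t s : ℝ, 0 ≤ t → 0 ≤ s → ∀ x : X, T t (S s x) = S (t + s) x - S t x
  δ : ℝ → ℝ
  δ_nonneg : ∀ t : ℝ, 0 ≤ t → 0 ≤ δ t
  δ_mono : MonotoneOn δ (Ici 0)
  δ_lim : Tendsto δ (𝓝[>] 0) (𝓝 0)
  SD : (ℝ → X) → ℝ → X₀
  SD_deriv : ∀ f : ℝ → X, ContinuousOn f (Ici 0) → ∀ t ∈ Ici (0:ℝ),
    HasDerivWithinAt (fun τ : ℝ => ∫ s in (0:ℝ)..τ, S (τ - s) (f s)) (SD f t) (Ici 0) t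
  SD_cont : ∀ f : ℝ → X, ContinuousOn f (Ici 0) → ContinuousOn (SD f) (Ici 0)
  SD_bound : ∀ f : ℝ → X, ContinuousOn f (Ici 0) → ∀ t ∈ Ici (0:ℝ),
    ‖SD f t‖ ≤ δ t * ⨆ s : Icc (0:ℝ) t, ‖f (s : ℝ)‖
  SDop : (ℝ → (X₀ →L[ℂ] X)) → ℝ → (X₀ →L[ℂ] X₀)
  SDop_apply : ∀ V : ℝ → (X₀ →L[ℂ] X), (∀ x : X₀, ContinuousOn (fun s => V s x) (Ici 0)) →
    ∀ t : ℝ, ∀ x : X₀, SDop V t x = SD (fun s => V s x) t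

variable {X : Type*} [NormedAddCommGroup X] [NormedSpace ℂ X] [CompleteSpace X]
  {X₀ : Submodule ℂ X}

/-- The perturbation operator `B(U) = S ⋄ (L ∘ U)`. -/
def MRSetting.Bop (M : MRSetting X X₀) (L : X₀ →L[ℂ] X) (U : ℝ → (X₀ →L[ℂ] X₀)) :
    ℝ → (X₀ →L[ℂ] X₀) :=
  M.SDop (fun s => L.comp (U s))



section helpers

lemma hp_opbound {E F : Type*} [NormedAddCommGroup E] [NormedSpace ℂ E] [CompleteSpace E]
    [NormedAddCommGroup F] [NormedSpace ℂ F] (A : ℝ → E →L[ℂ] F)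
    (hA : ∀ x, ContinuousOn (fun t => A t x) (Ici 0)) (b : ℝ) :
    ∃ C : ℝ, 0 ≤ C ∧ ∀ t, 0 ≤ t → t ≤ b → ‖A t‖ ≤ C := by
  have h := banach_steinhaus (g := fun t : Icc (0:ℝ) b => A t) (by
    intro x
    obtain ⟨C, hC⟩ := (isCompact_Icc (a := (0:ℝ)) (b := b)).exists_bound_of_continuousOn
      ((hA x).mono Icc_subset_Ici_self)
    exact ⟨C, fun t => hC t t.2⟩)
  obtain ⟨C, hC⟩ := h
  refine ⟨max C 0, le_max_right _ _, fun t h0 hb => (hC ⟨t, h0, hb⟩).trans (le_max_left _ _)⟩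

lemma hp_contapply {E F : Type*} [NormedAddCommGroup E] [NormedSpace ℂ E] [CompleteSpace E]
    [NormedAddCommGroup F] [NormedSpace ℂ F] (A : ℝ → E →L[ℂ] F)
    (hA : ∀ x, ContinuousOn (fun t => A t x) (Ici 0)) (b : ℝ) (D : Set ℝ) (k : ℝ → ℝ)
    (hk : ContinuousOn k D) (hkm : ∀ s ∈ D, 0 ≤ k s ∧ k s ≤ b) (f : ℝ → E)
    (hf : ContinuousOn f D) : ContinuousOn (fun s => A (k s) (f s)) D := by
  obtain ⟨C, hC0, hC⟩ := hp_opbound A hA b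
  intro s hs
  have h1 : Tendsto (fun r => A (k r) (f s)) (𝓝[D] s) (𝓝 (A (k s) (f s))) := by
    have := (hA (f s)).comp hk (fun r hr => (hkm r hr).1)
    exact this s hs
  have h2 : Tendsto (fun r => A (k r) (f r - f s)) (𝓝[D] s) (𝓝 0) := by
    have h3 : Tendsto (fun r => C * ‖f r - f s‖) (𝓝[D] s) (𝓝 0) := by
      have : Tendsto (fun r => f r - f s) (𝓝[D] s) (𝓝 0) := by
        have := (hf s hs).tendsto.sub_const (f s)
        simpa using this
      simpa using this.norm.const_mul C
    refine squeeze_zero_norm' ?_ h3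
    filter_upwards [self_mem_nhdsWithin] with r hr
    exact (A (k r)).le_of_opNorm_le (hC _ (hkm r hr).1 (hkm r hr).2) _
  have h4 := h1.add h2
  simp only [map_sub, add_sub_cancel, add_zero] at h4
  exact h4

namespace MRSetting

lemma cs (M : MRSetting X X₀) : CompleteSpace X₀ := M.closed.completeSpace_coe

lemma integrand_cont (M : MRSetting X X₀) (f : ℝ → X) (hf : ContinuousOn f (Ici 0)) (τ : ℝ) :
    ContinuousOn (fun s => M.S (τ - s) (f s)) (Icc 0 τ) :=
  hp_contapply M.S M.S_cont τ (Icc 0 τ) (fun s => τ - s) (by fun_prop)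
    (fun s hs => ⟨by linarith [hs.2], by linarith [hs.1]⟩) f (hf.mono Icc_subset_Ici_self)

lemma integrand_int (M : MRSetting X X₀) (f : ℝ → X) (hf : ContinuousOn f (Ici 0)) (τ : ℝ)
    (hτ : 0 ≤ τ) :
    IntervalIntegrable (fun s => M.S (τ - s) (f s)) volume 0 τ := by
  apply ContinuousOn.intervalIntegrable
  rw [uIcc_of_le hτ]
  exact M.integrand_cont f hf τ

lemma SD_unique (M : MRSetting X X₀) (f : ℝ → X) (hf : ContinuousOn f (Ici 0)) (t : ℝ)
    (ht : 0 ≤ t) (y : X₀)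
    (h : HasDerivWithinAt (fun τ : ℝ => ∫ s in (0:ℝ)..τ, M.S (τ - s) (f s)) y (Ici 0) t) :
    M.SD f t = y :=
  (uniqueDiffOn_Ici (0:ℝ) t ht).eq_deriv _ (M.SD_deriv f hf t ht) h

lemma SD_add (M : MRSetting X X₀) (f g : ℝ → X) (hf : ContinuousOn f (Ici 0))
    (hg : ContinuousOn g (Ici 0)) (t : ℝ) (ht : 0 ≤ t) :
    M.SD (fun s => f s + g s) t = M.SD f t + M.SD g t := by
  apply M.SD_unique _ (hf.add hg) t ht
  refine ((M.SD_deriv f hf t ht).add (M.SD_deriv g hg t ht)).congr_of_mem ?_ ht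
  intro τ hτ
  change (∫ s in (0:ℝ)..τ, M.S (τ - s) (f s + g s)) =
    (∫ s in (0:ℝ)..τ, M.S (τ - s) (f s)) + ∫ s in (0:ℝ)..τ, M.S (τ - s) (g s)
  simp only [map_add]
  exact intervalIntegral.integral_add (M.integrand_int f hf τ hτ) (M.integrand_int g hg τ hτ)

lemma SD_smul (M : MRSetting X X₀) (f : ℝ → X) (hf : ContinuousOn f (Ici 0)) (a : ℂ)
    (t : ℝ) (ht : 0 ≤ t) :
    M.SD (fun s => a • f s) t = a • M.SD f t := by
  apply M.SD_unique _ (hf.const_smul a) t ht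
  refine ((M.SD_deriv f hf t ht).const_smul a).congr_of_mem ?_ ht
  intro τ hτ
  change (∫ s in (0:ℝ)..τ, M.S (τ - s) (a • f s)) = a • ∫ s in (0:ℝ)..τ, M.S (τ - s) (f s)
  simp only [map_smul]
  exact intervalIntegral.integral_smul a _

lemma SD_sub (M : MRSetting X X₀) (f g : ℝ → X) (hf : ContinuousOn f (Ici 0))
    (hg : ContinuousOn g (Ici 0)) (t : ℝ) (ht : 0 ≤ t) :
    M.SD (fun s => f s - g s) t = M.SD f t - M.SD g t := by
  have h := M.SD_add f (fun s => (-1:ℂ) • g s) hf (hg.const_smul _) t ht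
  rw [M.SD_smul g hg _ t ht] at h
  simpa [sub_eq_add_neg] using h

lemma SD_le (M : MRSetting X X₀) (f : ℝ → X) (hf : ContinuousOn f (Ici 0)) (t : ℝ)
    (ht : 0 ≤ t) (C : ℝ) (hC : ∀ s, 0 ≤ s → s ≤ t → ‖f s‖ ≤ C) : ‖M.SD f t‖ ≤ M.δ t * C := by
  refine (M.SD_bound f hf t ht).trans (mul_le_mul_of_nonneg_left ?_ (M.δ_nonneg t ht))
  have : Nonempty (Icc (0:ℝ) t) := ⟨⟨0, le_rfl, ht⟩⟩
  exact ciSup_le fun s => hC s s.2.1 s.2.2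

lemma SD_sub_le (M : MRSetting X X₀) (f g : ℝ → X) (hf : ContinuousOn f (Ici 0))
    (hg : ContinuousOn g (Ici 0)) (t : ℝ)
    (ht : 0 ≤ t) (C : ℝ) (hC : ∀ s, 0 ≤ s → s ≤ t → ‖f s - g s‖ ≤ C) :
    ‖M.SD f t - M.SD g t‖ ≤ M.δ t * C := by
  rw [← M.SD_sub f g hf hg t ht]
  exact M.SD_le _ (hf.sub hg) t ht C hC

lemma SD_congr (M : MRSetting X X₀) (f g : ℝ → X) (hf : ContinuousOn f (Ici 0))
    (hg : ContinuousOn g (Ici 0)) (t : ℝ)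
    (ht : 0 ≤ t) (h : ∀ s, 0 ≤ s → s ≤ t → f s = g s) : M.SD f t = M.SD g t := by
  have := M.SD_sub_le f g hf hg t ht 0 (fun s h0 h1 => by simp [h s h0 h1])
  rw [mul_zero] at this
  exact sub_eq_zero.mp (norm_le_zero_iff.mp this)

lemma SD_sum (M : MRSetting X X₀) {ι : Type*} (s : Finset ι) (f : ι → ℝ → X)
    (hf : ∀ i ∈ s, ContinuousOn (f i) (Ici 0)) (t : ℝ) (ht : 0 ≤ t) :
    M.SD (fun r => ∑ i ∈ s, f i r) t = ∑ i ∈ s, M.SD (f i) t := by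
  classical
  induction s using Finset.induction_on with
  | empty =>
    simp only [Finset.sum_empty]
    have := M.SD_smul (fun _ => (0:X)) continuousOn_const 0 t ht
    simpa using this
  | insert i s hi ih =>
    simp only [Finset.sum_insert hi]
    rw [M.SD_add _ _ (hf i (Finset.mem_insert_self i s)) _ t ht,
      ih (fun j hj => hf j (Finset.mem_insert_of_mem hj))]
    exact continuousOn_finsetSum s (fun j hj => hf j (Finset.mem_insert_of_mem hj))

lemma δ_zero (M : MRSetting X X₀) : M.δ 0 = 0 := by
  refine le_antisymm ?_ (M.δ_nonneg 0 le_rfl)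
  refine ge_of_tendsto M.δ_lim ?_
  filter_upwards [self_mem_nhdsWithin] with t ht
  exact M.δ_mono (mem_Ici.2 le_rfl) (mem_Ici.2 (le_of_lt ht)) (le_of_lt ht)

lemma SD_zero (M : MRSetting X X₀) (f : ℝ → X) (hf : ContinuousOn f (Ici 0)) : M.SD f 0 = 0 := by
  have := M.SD_le f hf 0 le_rfl ‖f 0‖ (fun s h0 h1 => by rw [le_antisymm h1 h0])
  rw [M.δ_zero, zero_mul] at this
  exact norm_le_zero_iff.mp this

lemma shift_cont {E : Type*} [TopologicalSpace E] (f : ℝ → E) (hf : ContinuousOn f (Ici 0))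
    (t : ℝ) (ht : 0 ≤ t) : ContinuousOn (fun s => f (t + s)) (Ici 0) :=
  hf.comp (by fun_prop) (fun s (hs : 0 ≤ s) => by simp only [mem_Ici]; linarith)

lemma SD_shift (M : MRSetting X X₀) (f : ℝ → X) (hf : ContinuousOn f (Ici 0)) (h t : ℝ)
    (hh : 0 ≤ h) (ht : 0 ≤ t) :
    M.SD f (h + t) = M.T h (M.SD f t) + M.SD (fun s => f (t + s)) h := by
  have := M.cs
  have hft := shift_cont f hf t ht
  set v : ℝ → X₀ := fun τ => ∫ s in (0:ℝ)..τ, M.S (τ - s) (f s) with hv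
  set F : ℝ → X₀ := fun τ => ∫ s in (0:ℝ)..τ, M.S (τ - s) (f (t + s)) with hF
  set w : X := ∫ s in (0:ℝ)..t, f s with hw
  set D : ℝ → X₀ := fun k => M.T k (v t) + M.S k w with hD
  have key : ∀ k, 0 ≤ k → D k = v (t + k) - F k := by
    intro k hk
    have i1 : IntervalIntegrable (fun s => M.S (t + k - s) (f s)) volume 0 (t + k) :=
      M.integrand_int f hf (t + k) (by linarith)
    have i2 : IntervalIntegrable (fun s => M.S (t + k - s) (f s)) volume 0 t := by
      apply i1.mono_set
      rw [uIcc_of_le ht, uIcc_of_le (by linarith : (0:ℝ) ≤ t + k)]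
      exact Icc_subset_Icc_right (by linarith)
    have i3 : IntervalIntegrable (fun s => M.S (t + k - s) (f s)) volume t (t + k) := by
      apply i1.mono_set
      rw [uIcc_of_le (by linarith), uIcc_of_le (by linarith : (0:ℝ) ≤ t + k)]
      exact Icc_subset_Icc_left (by linarith)
    have i4 : IntervalIntegrable f volume 0 t := by
      apply ContinuousOn.intervalIntegrable
      rw [uIcc_of_le ht]
      exact hf.mono Icc_subset_Ici_self
    have e1 : v (t + k) = (∫ s in (0:ℝ)..t, M.S (t + k - s) (f s)) +
        ∫ s in t..(t + k), M.S (t + k - s) (f s) :=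
      (intervalIntegral.integral_add_adjacent_intervals i2 i3).symm
    have e2 : F k = ∫ s in t..(t + k), M.S (t + k - s) (f s) := by
      have := intervalIntegral.integral_comp_add_left
        (fun s => M.S (t + k - s) (f s)) t (a := 0) (b := k)
      rw [add_zero] at this
      rw [← this]
      simp only [hF]
      congr 1
      ext s
      congr 3
      ring
    have e3 : (∫ s in (0:ℝ)..t, M.S (t + k - s) (f s)) = M.T k (v t) + M.S k w := by
      have e4 : M.T k (v t) = ∫ s in (0:ℝ)..t, M.T k (M.S (t - s) (f s)) :=
        ((M.T k).intervalIntegral_comp_comm (M.integrand_int f hf t ht)).symm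
      have e5 : M.S k w = ∫ s in (0:ℝ)..t, M.S k (f s) :=
        ((M.S k).intervalIntegral_comp_comm i4).symm
      have i5 : IntervalIntegrable (fun s => M.S k (f s)) volume 0 t := by
        apply ContinuousOn.intervalIntegrable
        rw [uIcc_of_le ht]
        exact (M.S k).continuous.comp_continuousOn (hf.mono Icc_subset_Ici_self)
      have i6 : IntervalIntegrable (fun s => M.T k (M.S (t - s) (f s))) volume 0 t := by
        apply ContinuousOn.intervalIntegrable
        rw [uIcc_of_le ht]
        exact (M.T k).continuous.comp_continuousOn (M.integrand_cont f hf t)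
      rw [e4, e5, ← intervalIntegral.integral_add i6 i5]
      apply intervalIntegral.integral_congr
      intro s hs
      rw [uIcc_of_le ht] at hs
      simp only
      rw [M.TS k (t - s) hk (by linarith [hs.2])]
      rw [show k + (t - s) = t + k - s by ring]
      abel
    rw [e1, e2, e3]
    simp [hD]
  have hder : ∀ k, 0 ≤ k →
      HasDerivWithinAt D (M.SD f (t + k) - M.SD (fun s => f (t + s)) k) (Ici 0) k := by
    intro k hk
    have h1 : HasDerivWithinAt (fun r => v (t + r)) (M.SD f (t + k)) (Ici 0) k := by
      have ha : HasDerivWithinAt (fun r : ℝ => t + r) 1 (Ici 0) k :=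
        ((hasDerivAt_id k).const_add t).hasDerivWithinAt
      have hb := M.SD_deriv f hf (t + k) (by simp only [mem_Ici]; linarith)
      have := HasDerivWithinAt.scomp (h := fun r : ℝ => t + r) k hb ha
        (fun r (hr : 0 ≤ r) => by simp only [mem_Ici]; linarith)
      rw [one_smul] at this
      exact this
    have h2 := M.SD_deriv _ hft k hk
    exact (h1.sub h2).congr_of_mem (fun r hr => key r hr) hk
  have d0 := hder 0 le_rfl
  rw [M.SD_zero _ hft, add_zero, sub_zero] at d0
  have d1 : HasDerivWithinAt (fun k => D (h + k)) (M.T h (M.SD f t)) (Ici 0) 0 := by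
    have := (((M.T h).restrictScalars ℝ).hasFDerivAt (x := D 0)).comp_hasDerivWithinAt 0 d0
    have h3 := this.const_add (D h - M.T h (D 0))
    refine h3.congr_of_mem (fun k hk => ?_) (mem_Ici.2 le_rfl)
    simp only [hD, ContinuousLinearMap.coe_restrictScalars', Function.comp]
    rw [M.T_add h k hh hk, M.T_zero, M.S_zero]
    simp only [ContinuousLinearMap.comp_apply, map_add, M.TS h k hh hk]
    simp
    abel
  have d2 : HasDerivWithinAt (fun k => D (h + k))
      (M.SD f (t + h) - M.SD (fun s => f (t + s)) h) (Ici 0) 0 := by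
    have ha : HasDerivWithinAt (fun r : ℝ => h + r) 1 (Ici 0) 0 :=
      ((hasDerivAt_id (0:ℝ)).const_add h).hasDerivWithinAt
    have hb := hder h hh
    have := HasDerivWithinAt.scomp_of_eq (h := fun r : ℝ => h + r) (y := h) 0 hb ha
        (fun r (hr : 0 ≤ r) => by simp only [mem_Ici]; linarith) (by simp)
    rw [one_smul] at this
    exact this
  have := (uniqueDiffOn_Ici (0:ℝ) 0 (mem_Ici.2 le_rfl)).eq_deriv _ d1 d2
  rw [this, add_comm h t]
  abel

end MRSetting

lemma hp_schauder {E : Type*} [NormedAddCommGroup E] [NormedSpace ℂ E] (C : Set E)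
    (hC : IsCompact C) (η : ℝ) (hη : 0 < η) :
    ∃ (s : Finset E) (φ : E → E → ℝ), (∀ c ∈ s, c ∈ C) ∧
      (∀ c ∈ s, ContinuousOn (φ c) C) ∧ (∀ c ∈ s, ∀ x ∈ C, |φ c x| ≤ 1) ∧
      ∀ x ∈ C, ‖x - ∑ c ∈ s, ((φ c x : ℝ) : ℂ) • c‖ ≤ η := by
  classical
  obtain ⟨s0, hs0C, hs0f, hs0⟩ := hC.finite_cover_balls hη
  set s := hs0f.toFinset with hs
  set w : E → E → ℝ := fun c x => max 0 (η - ‖x - c‖) with hw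
  have hw0 : ∀ c x, 0 ≤ w c x := fun c x => le_max_left _ _
  have hpos : ∀ x ∈ C, 0 < ∑ c ∈ s, w c x := by
    intro x hx
    have := hs0 hx
    simp only [mem_iUnion, Metric.mem_ball, dist_eq_norm] at this
    obtain ⟨c, hc, hxc⟩ := this
    refine Finset.sum_pos' (fun c _ => hw0 c x) ⟨c, by simpa [hs] using hc, ?_⟩
    simp only [hw]
    exact lt_max_of_lt_right (by linarith)
  refine ⟨s, fun c x => w c x / ∑ d ∈ s, w d x, ?_, ?_, ?_, ?_⟩
  · intro c hc
    exact hs0C (by simpa [hs] using hc)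
  · intro c hc
    apply ContinuousOn.div
    · simp only [hw]; fun_prop
    · simp only [hw]; fun_prop
    · intro x hx
      exact (hpos x hx).ne'
  · intro c hc x hx
    rw [abs_of_nonneg (div_nonneg (hw0 c x) (hpos x hx).le), div_le_one (hpos x hx)]
    exact Finset.single_le_sum (f := fun d => w d x) (fun d _ => hw0 d x) hc
  · intro x hx
    set W := ∑ d ∈ s, w d x with hW
    have hWp : 0 < W := hpos x hx
    have h1 : ∑ c ∈ s, ((w c x / W : ℝ) : ℂ) = 1 := by
      rw [← Complex.ofReal_sum, ← Finset.sum_div, div_self hWp.ne', Complex.ofReal_one]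
    have h2 : x - ∑ c ∈ s, ((w c x / W : ℝ) : ℂ) • c =
        ∑ c ∈ s, ((w c x / W : ℝ) : ℂ) • (x - c) := by
      simp only [smul_sub, Finset.sum_sub_distrib]
      rw [← Finset.sum_smul, h1, one_smul]
    rw [h2]
    calc ‖∑ c ∈ s, ((w c x / W : ℝ) : ℂ) • (x - c)‖
        ≤ ∑ c ∈ s, (w c x / W) * η := by
          refine norm_sum_le_of_le _ fun c hc => ?_
          rw [norm_smul, Complex.norm_real, Real.norm_eq_abs,
            abs_of_nonneg (div_nonneg (hw0 c x) hWp.le)]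
          by_cases hxc : ‖x - c‖ ≤ η
          · exact mul_le_mul_of_nonneg_left hxc (div_nonneg (hw0 c x) hWp.le)
          · have : w c x = 0 := by
              simp only [hw]
              exact max_eq_left (by linarith)
            simp [this]
      _ = η := by
          rw [← Finset.sum_mul, ← Finset.sum_div, div_self hWp.ne', one_mul]

lemma hp_intshift (u : ℝ → ℝ) (hu : Continuous u) (B : ℝ) (hB : ∀ s, |u s| ≤ B) (t : ℝ)
    (ht : 0 ≤ t) (η : ℝ) (hη : 0 < η) :
    ∀ᶠ h in 𝓝[>] (0:ℝ), ∀ φ : ℝ → ℝ, Continuous φ → (∀ s, |φ s| ≤ 1) →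
      |∫ s in (0:ℝ)..t, u s * (φ (s + h) - φ s)| ≤ η := by
  have hB0 : 0 ≤ B := (abs_nonneg _).trans (hB 0)
  have huc : UniformContinuousOn u (Icc (-1) t) :=
    isCompact_Icc.uniformContinuousOn_of_continuous hu.continuousOn
  rw [Metric.uniformContinuousOn_iff] at huc
  obtain ⟨r, hr, hur⟩ := huc (η / (2 * (t + 1))) (by positivity)
  have hsmall : ∀ᶠ h in 𝓝[>] (0:ℝ), h < min (min r 1) (η / (4 * (B + 1))) := by
    apply nhdsWithin_le_nhds
    apply eventually_lt_nhds
    positivity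
  filter_upwards [hsmall, self_mem_nhdsWithin] with h hh hh0 φ hφ hφ1
  have hh0 : 0 < h := hh0
  have hhr : h < r := lt_of_lt_of_le hh ((min_le_left _ _).trans (min_le_left _ _))
  have hh1 : h < 1 := lt_of_lt_of_le hh ((min_le_left _ _).trans (min_le_right _ _))
  have hhB : h < η / (4 * (B + 1)) := lt_of_lt_of_le hh (min_le_right _ _)
  have ii : ∀ (g : ℝ → ℝ), Continuous g → ∀ a b, IntervalIntegrable g volume a b :=
    fun g hg a b => hg.intervalIntegrable a b
  set g : ℝ → ℝ := fun s => u (s - h) * φ s with hg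
  have hgc : Continuous g := by simp only [hg]; fun_prop
  have e1 : ∫ s in (0:ℝ)..t, u s * (φ (s + h) - φ s) =
      (∫ s in (0:ℝ)..t, u s * φ (s + h)) - ∫ s in (0:ℝ)..t, u s * φ s := by
    rw [← intervalIntegral.integral_sub (ii _ (by fun_prop) _ _) (ii _ (by fun_prop) _ _)]
    congr 1; ext s; ring
  have e2 : ∫ s in (0:ℝ)..t, u s * φ (s + h) = ∫ s in h..(t + h), g s := by
    have := intervalIntegral.integral_comp_add_right g h (a := 0) (b := t)
    rw [zero_add] at this
    rw [← this]
    congr 1; ext s; simp [hg]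
  have e3 : ∫ s in h..(t + h), g s =
      (∫ s in (0:ℝ)..t, g s) + (∫ s in t..(t+h), g s) - ∫ s in (0:ℝ)..h, g s := by
    rw [intervalIntegral.integral_add_adjacent_intervals (ii g hgc _ _) (ii g hgc _ _),
      ← intervalIntegral.integral_add_adjacent_intervals (ii g hgc 0 h) (ii g hgc h (t+h))]
    ring
  have e4 : (∫ s in (0:ℝ)..t, g s) - ∫ s in (0:ℝ)..t, u s * φ s =
      ∫ s in (0:ℝ)..t, (u (s - h) - u s) * φ s := by
    rw [← intervalIntegral.integral_sub (ii _ hgc _ _) (ii _ (by fun_prop) _ _)]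
    congr 1; ext s; simp only [hg]; ring
  have gB : ∀ s, ‖g s‖ ≤ B := by
    intro s
    simp only [hg, Real.norm_eq_abs, abs_mul]
    calc |u (s - h)| * |φ s| ≤ B * 1 := mul_le_mul (hB _) (hφ1 _) (abs_nonneg _) hB0
      _ = B := mul_one B
  have b1 : |∫ s in (0:ℝ)..t, (u (s - h) - u s) * φ s| ≤ (η / (2 * (t + 1))) * |t - 0| := by
    rw [← Real.norm_eq_abs]
    refine intervalIntegral.norm_integral_le_of_norm_le_const fun s hs => ?_
    rw [uIoc_of_le ht] at hs
    rw [Real.norm_eq_abs, abs_mul]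
    have := hur (s - h) ⟨by linarith [hs.1], by linarith [hs.2]⟩ s
      ⟨by linarith [hs.1], hs.2⟩ (by
        rw [Real.dist_eq, show s - h - s = -h by ring, abs_neg, abs_of_pos hh0]; exact hhr)
    rw [Real.dist_eq] at this
    calc _ ≤ (η / (2 * (t + 1))) * 1 :=
          mul_le_mul this.le (hφ1 _) (abs_nonneg _) (by positivity)
      _ = _ := mul_one _
  have b2 : |∫ s in t..(t+h), g s| ≤ B * |t + h - t| := by
    rw [← Real.norm_eq_abs]
    exact intervalIntegral.norm_integral_le_of_norm_le_const fun s _ => gB s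
  have b3 : |∫ s in (0:ℝ)..h, g s| ≤ B * |h - 0| := by
    rw [← Real.norm_eq_abs]
    exact intervalIntegral.norm_integral_le_of_norm_le_const fun s _ => gB s
  rw [sub_zero, abs_of_nonneg ht] at b1
  rw [add_sub_cancel_left, abs_of_pos hh0] at b2
  rw [sub_zero, abs_of_pos hh0] at b3
  have b4 : (η / (2 * (t + 1))) * t ≤ η / 2 := by
    rw [div_mul_eq_mul_div, div_le_div_iff₀ (by positivity) (by positivity)]
    nlinarith
  have b5 : B * h ≤ η / 4 := by
    have : (B + 1) * h ≤ η / 4 := by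
      rw [lt_div_iff₀ (by positivity)] at hhB
      linarith
    nlinarith
  rw [e1, e2, e3]
  have e5 : (∫ s in (0:ℝ)..t, g s) + (∫ s in t..(t+h), g s) - (∫ s in (0:ℝ)..h, g s)
      - ∫ s in (0:ℝ)..t, u s * φ s =
      (∫ s in (0:ℝ)..t, (u (s - h) - u s) * φ s) + (∫ s in t..(t+h), g s)
        - ∫ s in (0:ℝ)..h, g s := by
    rw [← e4]; ring
  rw [e5, abs_le]
  rw [abs_le] at b1 b2 b3
  constructor <;> linarith [b1.1, b1.2, b2.1, b2.2, b3.1, b3.2]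

namespace MRSetting

lemma scalar_small (M : MRSetting X X₀)
    (p : ℝ) (hp : 1 ≤ p) (Mhat ωhat : ℝ) (hMhat : 0 ≤ Mhat)
    (hq : ∀ f : ℝ → X, ContinuousOn f (Ici 0) → ∀ t ∈ Ici (0:ℝ),
      ‖M.SD f t‖ ≤ Mhat * (∫ s in (0:ℝ)..t, Real.exp (p * ωhat * (t - s)) * ‖f s‖ ^ p) ^ (1 / p))
    (c : X) (t : ℝ) (ht : 0 ≤ t) (η : ℝ) (hη : 0 < η) :
    ∃ ρ : ℝ, 0 < ρ ∧ ∀ a : ℝ → ℝ, Continuous a → (∀ s, |a s| ≤ 2) →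
      ∫ s in (0:ℝ)..t, a s ^ 2 ≤ ρ → ‖M.SD (fun s => (a s : ℂ) • c) t‖ ≤ η := by
  have hp0 : 0 < p := by linarith
  set θ : ℝ := (η / (Mhat + 1)) ^ p with hθ
  have hθ0 : 0 < θ := by positivity
  set D : ℝ := Real.exp (|p * ωhat| * t) * ‖c‖ ^ p + 1 with hD
  have hD0 : 0 < D := by positivity
  set κ : ℝ := θ / (2 * D * (t + 1)) with hκ
  have hκ0 : 0 < κ := by positivity
  set r : ℝ := κ ^ (1 / p) with hr
  have hr0 : 0 < r := by positivity
  set B : ℝ := 2 ^ p / r ^ 2 with hB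
  have hB0 : 0 < B := by positivity
  have hrp : r ^ p = κ := by
    rw [hr, ← Real.rpow_mul hκ0.le, one_div, inv_mul_cancel₀ hp0.ne', Real.rpow_one]
  refine ⟨θ / (2 * D * B), by positivity, fun a ha ha2 hρ => ?_⟩
  have hcont : Continuous (fun s => (a s : ℂ) • c) := by fun_prop
  refine (hq _ hcont.continuousOn t ht).trans ?_
  have pw : ∀ s, |a s| ^ p ≤ κ + B * a s ^ 2 := by
    intro s
    by_cases h : |a s| ≤ r
    · have := Real.rpow_le_rpow (abs_nonneg _) h hp0.le
      rw [hrp] at this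
      have : 0 ≤ B * a s ^ 2 := by positivity
      linarith
    · push Not at h
      have h1 := Real.rpow_le_rpow (abs_nonneg _) (ha2 s) hp0.le
      have h2 : r ^ 2 ≤ a s ^ 2 := by
        rw [← sq_abs (a s)]
        exact pow_le_pow_left₀ hr0.le h.le 2
      have h3 : (2:ℝ) ^ p ≤ B * a s ^ 2 := by
        rw [hB, div_mul_eq_mul_div, le_div_iff₀ (by positivity)]
        exact mul_le_mul_of_nonneg_left h2 (by positivity)
      linarith
  have hint : ∫ s in (0:ℝ)..t, Real.exp (p * ωhat * (t - s)) * ‖(a s : ℂ) • c‖ ^ p ≤ θ := by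
    have h1 : ∫ s in (0:ℝ)..t, Real.exp (p * ωhat * (t - s)) * ‖(a s : ℂ) • c‖ ^ p ≤
        ∫ s in (0:ℝ)..t, (D * κ + D * B * a s ^ 2) := by
      apply intervalIntegral.integral_mono_on ht
      · apply Continuous.intervalIntegrable
        have : Continuous fun s => ‖(a s : ℂ) • c‖ ^ p :=
          hcont.norm.rpow_const (fun s => Or.inr hp0.le)
        fun_prop
      · apply Continuous.intervalIntegrable
        fun_prop
      · intro s hs
        rw [norm_smul, Complex.norm_real, Real.norm_eq_abs,
          Real.mul_rpow (abs_nonneg _) (norm_nonneg _)]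
        have h2 : Real.exp (p * ωhat * (t - s)) ≤ Real.exp (|p * ωhat| * t) := by
          apply Real.exp_le_exp.2
          calc p * ωhat * (t - s) ≤ |p * ωhat| * (t - s) :=
                mul_le_mul_of_nonneg_right (le_abs_self _) (by linarith [hs.2])
            _ ≤ _ := mul_le_mul_of_nonneg_left (by linarith [hs.1]) (abs_nonneg _)
        have h3 : 0 ≤ |a s| ^ p := by positivity
        have h4 : 0 ≤ ‖c‖ ^ p := by positivity
        calc Real.exp (p * ωhat * (t - s)) * (|a s| ^ p * ‖c‖ ^ p)
            ≤ Real.exp (|p * ωhat| * t) * (|a s| ^ p * ‖c‖ ^ p) :=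
              mul_le_mul_of_nonneg_right h2 (by positivity)
          _ = (D - 1) * |a s| ^ p := by rw [hD]; ring
          _ ≤ D * |a s| ^ p := mul_le_mul_of_nonneg_right (by linarith) h3
          _ ≤ D * (κ + B * a s ^ 2) := mul_le_mul_of_nonneg_left (pw s) hD0.le
          _ = _ := by ring
    have h2 : ∫ s in (0:ℝ)..t, (D * κ + D * B * a s ^ 2) =
        D * κ * t + D * B * ∫ s in (0:ℝ)..t, a s ^ 2 := by
      rw [intervalIntegral.integral_add (by simp)
        (Continuous.intervalIntegrable (by fun_prop) _ _)]
      rw [intervalIntegral.integral_const, intervalIntegral.integral_const_mul]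
      simp only [smul_eq_mul]
      ring
    have h3 : D * κ * t ≤ θ / 2 := by
      rw [hκ]
      rw [mul_div_assoc', div_mul_eq_mul_div, div_le_div_iff₀ (by positivity) (by positivity)]
      have : 0 < D * θ := by positivity
      nlinarith
    have h4 : D * B * ∫ s in (0:ℝ)..t, a s ^ 2 ≤ θ / 2 := by
      calc _ ≤ D * B * (θ / (2 * D * B)) := mul_le_mul_of_nonneg_left hρ (by positivity)
        _ = θ / 2 := by field_simp
    linarith
  have hnn : 0 ≤ ∫ s in (0:ℝ)..t, Real.exp (p * ωhat * (t - s)) * ‖(a s : ℂ) • c‖ ^ p :=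
    intervalIntegral.integral_nonneg ht (fun s _ => by positivity)
  have h5 := Real.rpow_le_rpow hnn hint (by positivity : 0 ≤ 1 / p)
  have h6 : θ ^ (1 / p) = η / (Mhat + 1) := by
    rw [hθ, ← Real.rpow_mul (by positivity), mul_one_div_cancel hp0.ne', Real.rpow_one]
  rw [h6] at h5
  calc _ ≤ Mhat * (η / (Mhat + 1)) := mul_le_mul_of_nonneg_left h5 hMhat
    _ ≤ η := by
      rw [mul_div_assoc', div_le_iff₀ (by positivity)]
      nlinarith

lemma scalar_shift (M : MRSetting X X₀)
    (p : ℝ) (hp : 1 ≤ p) (Mhat ωhat : ℝ) (hMhat : 0 ≤ Mhat)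
    (hq : ∀ f : ℝ → X, ContinuousOn f (Ici 0) → ∀ t ∈ Ici (0:ℝ),
      ‖M.SD f t‖ ≤ Mhat * (∫ s in (0:ℝ)..t, Real.exp (p * ωhat * (t - s)) * ‖f s‖ ^ p) ^ (1 / p))
    (K : X₀ →L[ℂ] X) (hK : IsCompactOperator ⇑K)
    (c : X) (t : ℝ) (ht : 0 ≤ t) (η : ℝ) (hη : 0 < η) :
    ∀ᶠ h in 𝓝[>] (0:ℝ), ∀ φ : ℝ → ℝ, Continuous φ → (∀ s, |φ s| ≤ 1) →
      ‖K (M.SD (fun s => ((φ (s + h) - φ s : ℝ) : ℂ) • c) t)‖ ≤ η := by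
  by_contra hcon
  rw [not_eventually] at hcon
  obtain ⟨h, hh, hbad⟩ := Filter.exists_seq_forall_of_frequently hcon
  push Not at hbad
  choose φ hφc hφ1 hφη using hbad
  set ψ : ℕ → ℝ → ℝ := fun n s => φ n (s + h n) - φ n s with hψ
  have hψc : ∀ n, Continuous (ψ n) := fun n => by
    have := hφc n
    simp only [hψ]; fun_prop
  have hψ2 : ∀ n s, |ψ n s| ≤ 2 := fun n s => by
    have h1 := hφ1 n (s + h n)
    have h2 := hφ1 n s
    simp only [hψ]
    rw [abs_le] at *
    constructor <;> linarith [h1.1, h1.2, h2.1, h2.2]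
  have hcc : ∀ u : ℝ → ℝ, Continuous u → ContinuousOn (fun s => (u s : ℂ) • c) (Ici 0) :=
    fun u hu => Continuous.continuousOn (by fun_prop)
  set y : ℕ → X := fun n => K (M.SD (fun s => (ψ n s : ℂ) • c) t) with hy
  have hyη : ∀ n, η < ‖y n‖ := hφη
  obtain ⟨C, hC, hKC⟩ := hK.image_subset_compact_of_bounded (f := (K : X₀ →ₗ[ℂ] X))
    (Metric.isBounded_closedBall (x := (0:X₀)) (r := M.δ t * (2 * ‖c‖)))
  have hyC : ∀ n, y n ∈ C := by
    intro n
    apply hKC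
    refine ⟨M.SD (fun s => (ψ n s : ℂ) • c) t, ?_, rfl⟩
    rw [mem_closedBall_zero_iff]
    apply M.SD_le _ (hcc _ (hψc n)) t ht
    intro s _ _
    rw [norm_smul, Complex.norm_real, Real.norm_eq_abs]
    exact mul_le_mul_of_nonneg_right (hψ2 n s) (norm_nonneg _)
  obtain ⟨y0, -, σ, hσ, hlim⟩ := hC.tendsto_subseq hyC
  have hy0 : η ≤ ‖y0‖ := ge_of_tendsto' hlim.norm (fun n => (hyη _).le)
  have hev : ∀ᶠ n in atTop, ‖y (σ n) - y0‖ ≤ η / 4 := by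
    have := (hlim.sub_const y0).norm
    rw [sub_self, norm_zero] at this
    exact this.eventually_le_const (by positivity)
  have hhσ : Tendsto (fun n => h (σ n)) atTop (𝓝[>] 0) := hh.comp hσ.tendsto_atTop
  have build : ∀ N : ℕ, ∃ u : ℝ → ℝ, Continuous u ∧ (∀ s, |u s| ≤ 2 * N) ∧
      ∫ s in (0:ℝ)..t, u s ^ 2 ≤ N * (4 * t + 2) ∧
      ‖K (M.SD (fun s => (u s : ℂ) • c) t) - (N : ℂ) • y0‖ ≤ N * (η / 4) := by
    intro N
    induction N with
    | zero =>
      refine ⟨fun _ => 0, continuous_const, by simp, by simp, ?_⟩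
      have := M.SD_smul (fun _ => (0:X)) continuousOn_const 0 t ht
      simp only [zero_smul] at this
      simp [this]
    | succ N ih =>
      obtain ⟨u, huc, hu2, hui, huK⟩ := ih
      have hs := hhσ.eventually (hp_intshift u huc _ hu2 t ht 1 one_pos)
      obtain ⟨n, hn1, hn2⟩ := (hs.and hev).exists
      have hn1 := hn1 (φ (σ n)) (hφc _) (hφ1 _)
      refine ⟨fun s => u s + ψ (σ n) s, huc.add (hψc _), ?_, ?_, ?_⟩
      · intro s
        refine (abs_add_le _ _).trans ?_
        push_cast
        linarith [hu2 s, hψ2 (σ n) s]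
      · have hi : ∀ g : ℝ → ℝ, Continuous g → IntervalIntegrable g volume 0 t :=
          fun g hg => hg.intervalIntegrable _ _
        have hψn := hψc (σ n)
        have e : ∫ s in (0:ℝ)..t, (u s + ψ (σ n) s) ^ 2 =
            (∫ s in (0:ℝ)..t, u s ^ 2) + 2 * (∫ s in (0:ℝ)..t, u s * ψ (σ n) s) +
              ∫ s in (0:ℝ)..t, ψ (σ n) s ^ 2 := by
          rw [← intervalIntegral.integral_const_mul,
            ← intervalIntegral.integral_add (hi _ (by fun_prop)) (hi _ (by fun_prop)),
            ← intervalIntegral.integral_add (hi _ (by fun_prop)) (hi _ (by fun_prop))]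
          congr 1; ext s; ring
        have e2 : ∫ s in (0:ℝ)..t, ψ (σ n) s ^ 2 ≤ 4 * t := by
          have := intervalIntegral.integral_mono_on (μ := volume) ht
            (hi (fun s => ψ (σ n) s ^ 2) (by fun_prop))
            (hi (fun _ => 4) (by fun_prop)) (fun s _ => by
              have := hψ2 (σ n) s
              rw [← sq_abs]
              nlinarith [abs_nonneg (ψ (σ n) s)])
          simpa [mul_comm] using this
        rw [e]
        push_cast
        have := (abs_le.1 hn1).2
        have h9 : ∫ s in (0:ℝ)..t, u s * ψ (σ n) s ≤ 1 := this
        nlinarith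
      · have e : M.SD (fun s => ((u s + ψ (σ n) s : ℝ) : ℂ) • c) t =
            M.SD (fun s => (u s : ℂ) • c) t + M.SD (fun s => (ψ (σ n) s : ℂ) • c) t := by
          rw [← M.SD_add _ _ (hcc _ huc) (hcc _ (hψc _)) t ht]
          congr 1; ext s; push_cast; rw [add_smul]
        rw [e, map_add]
        have e2 : K (M.SD (fun s => (u s : ℂ) • c) t) + K (M.SD (fun s => (ψ (σ n) s : ℂ) • c) t)
            - ((N + 1 : ℕ) : ℂ) • y0 =
            (K (M.SD (fun s => (u s : ℂ) • c) t) - (N : ℂ) • y0) + (y (σ n) - y0) := by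
          push_cast
          rw [add_smul, one_smul]
          simp only [hy]
          abel
        rw [e2]
        refine (norm_add_le _ _).trans ?_
        push_cast
        linarith
  obtain ⟨ρ, hρ, hsm⟩ := M.scalar_small p hp Mhat ωhat hMhat hq c t ht (η / (4 * (‖K‖ + 1)))
    (by positivity)
  obtain ⟨N, hN⟩ := exists_nat_gt ((4 * t + 2) / ρ)
  have hN0 : (0:ℝ) < N := lt_of_le_of_lt (by positivity) hN
  obtain ⟨u, huc, hu2, hui, huK⟩ := build N
  have ha := hsm (fun s => (N:ℝ)⁻¹ * u s) (by fun_prop) (by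
    intro s
    rw [abs_mul, abs_of_pos (by positivity), inv_mul_le_iff₀ hN0]
    linarith [hu2 s]) (by
    simp only [mul_pow]
    rw [intervalIntegral.integral_const_mul]
    calc _ ≤ (N:ℝ)⁻¹ ^ 2 * (N * (4 * t + 2)) := mul_le_mul_of_nonneg_left hui (by positivity)
      _ = (4 * t + 2) / N := by field_simp
      _ ≤ ρ := by
        rw [div_le_iff₀ hN0]
        rw [div_lt_iff₀ hρ] at hN
        linarith)
  have e : M.SD (fun s => (((N:ℝ)⁻¹ * u s : ℝ) : ℂ) • c) t =
      ((N:ℝ)⁻¹ : ℂ) • M.SD (fun s => (u s : ℂ) • c) t := by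
    rw [← M.SD_smul _ (hcc _ huc) _ t ht]
    congr 1; ext s; push_cast; rw [mul_smul]
  rw [e, norm_smul] at ha
  have hNn : ‖((N:ℝ)⁻¹ : ℂ)‖ = (N:ℝ)⁻¹ := by simp
  rw [hNn, inv_mul_le_iff₀ hN0] at ha
  have h1 : ‖K (M.SD (fun s => (u s : ℂ) • c) t)‖ ≤ N * (η / 4) := by
    refine (K.le_opNorm _).trans ?_
    calc _ ≤ ‖K‖ * (N * (η / (4 * (‖K‖ + 1)))) := mul_le_mul_of_nonneg_left ha K.opNorm_nonneg
      _ ≤ (‖K‖ + 1) * (N * (η / (4 * (‖K‖ + 1)))) :=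
        mul_le_mul_of_nonneg_right (by linarith) (by positivity)
      _ = N * (η / 4) := by field_simp
  have h2 : ‖(N : ℂ) • y0‖ = N * ‖y0‖ := by simp [norm_smul]
  have h3 : ‖(N : ℂ) • y0‖ ≤ ‖K (M.SD (fun s => (u s : ℂ) • c) t)‖ +
      ‖K (M.SD (fun s => (u s : ℂ) • c) t) - (N : ℂ) • y0‖ := by
    have := norm_sub_le (K (M.SD (fun s => (u s : ℂ) • c) t))
      (K (M.SD (fun s => (u s : ℂ) • c) t) - (N : ℂ) • y0)
    rwa [sub_sub_cancel] at this
  rw [h2] at h3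
  have : (N:ℝ) * η ≤ N * ‖y0‖ := mul_le_mul_of_nonneg_left hy0 hN0.le
  have : 0 < N * η := by positivity
  linarith

lemma compact_shift (M : MRSetting X X₀)
    (p : ℝ) (hp : 1 ≤ p) (Mhat ωhat : ℝ) (hMhat : 0 ≤ Mhat)
    (hq : ∀ f : ℝ → X, ContinuousOn f (Ici 0) → ∀ t ∈ Ici (0:ℝ),
      ‖M.SD f t‖ ≤ Mhat * (∫ s in (0:ℝ)..t, Real.exp (p * ωhat * (t - s)) * ‖f s‖ ^ p) ^ (1 / p))
    (K : X₀ →L[ℂ] X) (hK : IsCompactOperator ⇑K)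
    (C : Set X) (hC : IsCompact C) (t : ℝ) (ht : 0 ≤ t) (η : ℝ) (hη : 0 < η) :
    ∀ᶠ h in 𝓝[>] (0:ℝ), ∀ f : ℝ → X, Continuous f → (∀ s, f s ∈ C) →
      ‖K (M.SD (fun s => f (s + h) - f s) t)‖ ≤ η := by
  have hδ := M.δ_nonneg t ht
  set ζ : ℝ := η / (4 * (‖K‖ + 1) * (M.δ t + 1)) with hζ
  have hζ0 : 0 < ζ := by positivity
  obtain ⟨s, φ, hsC, hφc, hφ1, hφ⟩ := hp_schauder C hC ζ hζ0
  have hall : ∀ᶠ h in 𝓝[>] (0:ℝ), ∀ c ∈ s, ∀ φ : ℝ → ℝ, Continuous φ → (∀ s, |φ s| ≤ 1) →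
      ‖K (M.SD (fun s => ((φ (s + h) - φ s : ℝ) : ℂ) • c) t)‖ ≤ η / (2 * (s.card + 1)) := by
    rw [Filter.eventually_all_finset]
    intro c _
    exact M.scalar_shift p hp Mhat ωhat hMhat hq K hK c t ht _ (by positivity)
  filter_upwards [hall] with h hh f hf hfC
  set Φ : X → ℝ → ℝ := fun c r => φ c (f r) with hΦ
  have hΦc : ∀ c ∈ s, Continuous (Φ c) := fun c hc => (hφc c hc).comp_continuous hf hfC
  set G : X → ℝ → X := fun c r => ((Φ c (r + h) - Φ c r : ℝ) : ℂ) • c with hG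
  have hGc : ∀ c ∈ s, ContinuousOn (G c) (Ici 0) := fun c hc => by
    have := hΦc c hc
    exact Continuous.continuousOn (by simp only [hG]; fun_prop)
  have hfc : ContinuousOn (fun r => f (r + h) - f r) (Ici 0) :=
    Continuous.continuousOn (by fun_prop)
  have h1 : ‖M.SD (fun r => f (r + h) - f r) t - M.SD (fun r => ∑ c ∈ s, G c r) t‖ ≤
      M.δ t * (2 * ζ) := by
    apply M.SD_sub_le _ _ hfc (continuousOn_finsetSum s hGc) t ht
    intro r _ _
    have e : f (r + h) - f r - ∑ c ∈ s, G c r =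
        (f (r + h) - ∑ c ∈ s, ((φ c (f (r + h)) : ℝ) : ℂ) • c) -
        (f r - ∑ c ∈ s, ((φ c (f r) : ℝ) : ℂ) • c) := by
      simp only [hG, hΦ, Complex.ofReal_sub, sub_smul, Finset.sum_sub_distrib]
      abel
    rw [e]
    refine (norm_sub_le _ _).trans ?_
    linarith [hφ _ (hfC (r + h)), hφ _ (hfC r)]
  rw [M.SD_sum s G hGc t ht] at h1
  have h2 : ‖K (∑ c ∈ s, M.SD (G c) t)‖ ≤ η / 2 := by
    rw [map_sum]
    calc _ ≤ ∑ c ∈ s, η / (2 * (s.card + 1)) :=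
          norm_sum_le_of_le _ fun c hc => hh c hc (Φ c) (hΦc c hc) (fun r => hφ1 c hc _ (hfC r))
      _ = s.card * (η / (2 * (s.card + 1))) := by simp
      _ ≤ (s.card + 1) * (η / (2 * (s.card + 1))) :=
        mul_le_mul_of_nonneg_right (by linarith) (by positivity)
      _ = η / 2 := by field_simp
  have h3 : ‖K (M.SD (fun r => f (r + h) - f r) t - ∑ c ∈ s, M.SD (G c) t)‖ ≤ η / 2 := by
    refine (K.le_opNorm _).trans ?_
    calc _ ≤ ‖K‖ * (M.δ t * (2 * ζ)) := mul_le_mul_of_nonneg_left h1 K.opNorm_nonneg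
      _ ≤ (‖K‖ + 1) * ((M.δ t + 1) * (2 * ζ)) := by
        gcongr <;> linarith
      _ = η / 2 := by rw [hζ]; field_simp; ring
  have h4 := norm_add_le (K (M.SD (fun r => f (r + h) - f r) t - ∑ c ∈ s, M.SD (G c) t))
    (K (∑ c ∈ s, M.SD (G c) t))
  rw [← map_add, sub_add_cancel] at h4
  linarith

end MRSetting

lemma hp_contOn {E : Type*} [SeminormedAddCommGroup E] (U : ℝ → E) (J : Set ℝ)
    (h : ∀ t ∈ J, ∀ η : ℝ, 0 < η → ∃ r : ℝ, 0 < r ∧ ∀ a ∈ J, ∀ b ∈ J, |a - t| < r → |b - t| < r →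
      b < a → ‖U a - U b‖ ≤ η) : ContinuousOn U J := by
  intro t ht
  rw [Metric.continuousWithinAt_iff]
  intro η hη
  obtain ⟨r, hr, hU⟩ := h t ht (η / 2) (by positivity)
  refine ⟨r, hr, fun {x} hx hxt => ?_⟩
  rw [Real.dist_eq] at hxt
  rw [dist_eq_norm]
  rcases lt_trichotomy x t with h1 | h1 | h1
  · have := hU t ht x hx (by simpa using hr) hxt h1
    rw [norm_sub_rev]
    linarith
  · subst h1; simpa using hη
  · have := hU x hx t ht hxt (by simpa using hr) h1
    linarith

section clm
variable {E F : Type*} [NormedAddCommGroup E] [NormedSpace ℂ E] [NormedAddCommGroup F]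
  [NormedSpace ℂ F]

lemma clm_tendsto_zero {ι : Type*} {l : Filter ι} {U : ι → E →L[ℂ] F} :
    Tendsto U l (𝓝 0) ↔ Tendsto (fun i => ‖U i‖) l (𝓝 0) :=
  tendsto_zero_iff_norm_tendsto_zero (E := E →L[ℂ] F)

lemma clm_contOn (U : ℝ → E →L[ℂ] F) (J : Set ℝ)
    (h : ∀ t ∈ J, ∀ η : ℝ, 0 < η → ∃ r : ℝ, 0 < r ∧ ∀ a ∈ J, ∀ b ∈ J, |a - t| < r → |b - t| < r →
      b < a → ‖U a - U b‖ ≤ η) : ContinuousOn U J :=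
  hp_contOn (E := E →L[ℂ] F) U J h

lemma clm_contAt {U : ℝ → E →L[ℂ] F} {t : ℝ} (h : ContinuousAt U t) (η : ℝ) (hη : 0 < η) :
    ∃ r : ℝ, 0 < r ∧ ∀ x, |x - t| < r → ‖U x - U t‖ < η := by
  obtain ⟨r, hr, h⟩ := (Metric.continuousAt_iff (β := E →L[ℂ] F)).1 h η hη
  refine ⟨r, hr, fun x hx => ?_⟩
  rw [← dist_eq_norm]
  exact h hx

lemma clm_unif {U : ℝ → E →L[ℂ] F} {a b : ℝ} (h : ContinuousOn U (Icc a b)) (η : ℝ) (hη : 0 < η) :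
    ∃ r : ℝ, 0 < r ∧ ∀ x ∈ Icc a b, ∀ y ∈ Icc a b, |x - y| < r → ‖U x - U y‖ < η := by
  have huc : UniformContinuousOn U (Icc a b) :=
    isCompact_Icc.uniformContinuousOn_of_continuous h
  obtain ⟨r, hr, h⟩ := (Metric.uniformContinuousOn_iff (β := E →L[ℂ] F)).1 huc η hη
  refine ⟨r, hr, fun x hx y hy hxy => ?_⟩
  rw [← dist_eq_norm]
  exact h x hx y hy hxy

lemma clm_compact_closure [CompleteSpace F] (A : E →L[ℂ] F)
    (h : ∀ η : ℝ, 0 < η → ∃ A' : E →L[ℂ] F, IsCompactOperator ⇑A' ∧ ‖A - A'‖ < η) :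
    IsCompactOperator ⇑A := by
  have hclos : IsClosed {A : E →L[ℂ] F | IsCompactOperator ⇑A} :=
    isClosed_setOfPred_isCompactOperator
  have h1 : A ∈ closure {A : E →L[ℂ] F | IsCompactOperator ⇑A} := by
    refine (Metric.mem_closure_iff (α := E →L[ℂ] F)).2 fun η hη => ?_
    obtain ⟨A', h1, h2⟩ := h η hη
    exact ⟨A', h1, by rw [dist_eq_norm]; exact h2⟩
  rw [hclos.closure_eq] at h1
  exact h1

end clm

namespace MRSetting

lemma SDop_norm_le (M : MRSetting X X₀) (V : ℝ → (X₀ →L[ℂ] X))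
    (hV : ∀ x : X₀, ContinuousOn (fun s => V s x) (Ici 0)) (t : ℝ) (ht : 0 ≤ t) (C : ℝ)
    (hC0 : 0 ≤ C) (hC : ∀ s, 0 ≤ s → s ≤ t → ‖V s‖ ≤ C) : ‖M.SDop V t‖ ≤ M.δ t * C := by
  refine ContinuousLinearMap.opNorm_le_bound _ (mul_nonneg (M.δ_nonneg t ht) hC0) fun x => ?_
  rw [M.SDop_apply V hV, mul_assoc]
  exact M.SD_le _ (hV x) t ht _ fun s h0 h1 => (V s).le_of_opNorm_le (hC s h0 h1) x

lemma SDop_sub_le (M : MRSetting X X₀) (V W : ℝ → (X₀ →L[ℂ] X))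
    (hV : ∀ x : X₀, ContinuousOn (fun s => V s x) (Ici 0))
    (hW : ∀ x : X₀, ContinuousOn (fun s => W s x) (Ici 0)) (t : ℝ) (ht : 0 ≤ t) (C : ℝ)
    (hC0 : 0 ≤ C) (hC : ∀ s, 0 ≤ s → s ≤ t → ‖V s - W s‖ ≤ C) :
    ‖M.SDop V t - M.SDop W t‖ ≤ M.δ t * C := by
  refine ContinuousLinearMap.opNorm_le_bound _ (mul_nonneg (M.δ_nonneg t ht) hC0) fun x => ?_
  rw [sub_apply, M.SDop_apply V hV, M.SDop_apply W hW, mul_assoc]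
  exact M.SD_sub_le _ _ (hV x) (hW x) t ht _
    fun s h0 h1 => (V s - W s).le_of_opNorm_le (hC s h0 h1) x

lemma SDop_shift (M : MRSetting X X₀) (V : ℝ → (X₀ →L[ℂ] X))
    (hV : ∀ x : X₀, ContinuousOn (fun s => V s x) (Ici 0)) (h t : ℝ) (hh : 0 ≤ h) (ht : 0 ≤ t) :
    M.SDop V (h + t) = (M.T h).comp (M.SDop V t) + M.SDop (fun s => V (t + s)) h := by
  ext x : 1
  rw [add_apply, ContinuousLinearMap.comp_apply, M.SDop_apply V hV,
    M.SDop_apply V hV, M.SDop_apply _ (fun x => shift_cont (fun s => V s x) (hV x) t ht)]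
  exact M.SD_shift _ (hV x) h t hh ht

lemma SDop_sc (M : MRSetting X X₀) (V : ℝ → (X₀ →L[ℂ] X))
    (hV : ∀ x : X₀, ContinuousOn (fun s => V s x) (Ici 0)) (x : X₀) :
    ContinuousOn (fun t => M.SDop V t x) (Ici 0) := by
  simp only [M.SDop_apply V hV]
  exact M.SD_cont _ (hV x)

lemma SDop_tendsto (M : MRSetting X X₀) (V : ℝ → (X₀ →L[ℂ] X))
    (hV : ∀ x : X₀, ContinuousOn (fun s => V s x) (Ici 0)) :
    Tendsto (M.SDop V) (𝓝[>] 0) (𝓝 0) := by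
  have := M.cs
  obtain ⟨C, hC0, hC⟩ := hp_opbound V hV 1
  have h1 : Tendsto (fun t => M.δ t * C) (𝓝[>] 0) (𝓝 0) := by
    simpa using M.δ_lim.mul_const C
  rw [clm_tendsto_zero]
  refine squeeze_zero' (Eventually.of_forall fun t => norm_nonneg _) ?_ h1
  have h2 : ∀ᶠ h in 𝓝[>] (0:ℝ), h < 1 := nhdsWithin_le_nhds (eventually_lt_nhds one_pos)
  filter_upwards [self_mem_nhdsWithin, h2] with t ht ht1
  exact M.SDop_norm_le V hV t (le_of_lt ht) C hC0 fun s h0 hs => hC s h0 (by linarith)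

lemma normcont_sc {V : ℝ → (X₀ →L[ℂ] X)} (hV : ContinuousOn V (Ici 0)) (x : X₀) :
    ContinuousOn (fun s => V s x) (Ici 0) := hV.clm_apply continuousOn_const

/-- The image of a norm continuous family is norm continuous. -/
lemma SDop_normcont (M : MRSetting X X₀) (V : ℝ → (X₀ →L[ℂ] X)) (hVn : ContinuousOn V (Ici 0)) :
    ContinuousOn (M.SDop V) (Ici 0) := by
  have := M.cs
  have hV := fun x => normcont_sc hVn x
  apply clm_contOn
  intro t (ht : 0 ≤ t) η hη
  obtain ⟨C, hC0, hC⟩ := hp_opbound M.T M.T_cont (t + 1)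
  have hδ := M.δ_nonneg (t + 1) (by linarith)
  obtain ⟨r, hr, hur⟩ := clm_unif (hVn.mono (Icc_subset_Ici_self : Icc 0 (t + 1) ⊆ Ici 0)) (η / (2 * (M.δ (t + 1) + 1))) (by positivity)
  have hlim : ∀ᶠ h in 𝓝[>] (0:ℝ), ‖M.SDop V h‖ < η / (2 * (C + 1)) := by
    have := clm_tendsto_zero.1 (M.SDop_tendsto V hV)
    exact this.eventually_lt_const (by positivity)
  rw [eventually_nhdsWithin_iff, Metric.eventually_nhds_iff] at hlim
  obtain ⟨r', hr', hlim⟩ := hlim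
  refine ⟨min (min (r / 2) (r' / 2)) 1, by positivity, fun a ha b hb hat hbt hba => ?_⟩
  simp only [lt_min_iff, abs_lt] at hat hbt
  have hb : 0 ≤ b := hb
  obtain ⟨h, rfl⟩ : ∃ h, a = b + h := ⟨a - b, by ring⟩
  have hh : 0 < h := by linarith
  have hhr : h < r := by linarith [hat.1.1.2, hbt.1.1.1]
  have hhr' : h < r' := by linarith [hat.1.2.2, hbt.1.2.1]
  rw [M.SDop_shift V hV b h hb hh.le]
  have h1 : ‖(M.T b).comp (M.SDop V h)‖ ≤ η / 2 := by
    refine (ContinuousLinearMap.opNorm_comp_le _ _).trans ?_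
    have e1 := hC b hb (by linarith [hbt.2.2])
    have e2 := hlim (y := h) (by rw [Real.dist_eq, sub_zero, abs_of_pos hh]; exact hhr') hh
    calc _ ≤ C * (η / (2 * (C + 1))) := by gcongr
      _ ≤ (C + 1) * (η / (2 * (C + 1))) := by gcongr; linarith
      _ = η / 2 := by field_simp
  have h2 : ‖M.SDop (fun s => V (h + s)) b - M.SDop V b‖ ≤ η / 2 := by
    have e1 := M.SDop_sub_le (fun s => V (h + s)) V
      (fun x => shift_cont (fun s => V s x) (hV x) h hh.le) hV b hb
      (η / (2 * (M.δ (t + 1) + 1))) (by positivity) (by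
        intro s hs hsb
        refine (hur _ ⟨by linarith, by linarith [hat.2.2]⟩ _ ⟨hs, by linarith [hbt.2.2]⟩ ?_).le
        rw [add_sub_cancel_right, abs_of_pos hh]
        exact hhr)
    have e2 : M.δ b ≤ M.δ (t + 1) :=
      M.δ_mono hb (by simp only [mem_Ici]; linarith) (by linarith [hbt.2.2])
    calc _ ≤ _ := e1
      _ ≤ (M.δ (t + 1) + 1) * (η / (2 * (M.δ (t + 1) + 1))) := by gcongr; linarith
      _ = η / 2 := by field_simp
  rw [add_sub_assoc]
  refine (norm_add_le _ _).trans ?_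
  linarith

lemma SDop_compact0 (M : MRSetting X X₀) (V : ℝ → (X₀ →L[ℂ] X)) (hVn : ContinuousOn V (Ici 0))
    (hVc : ∀ t, 0 ≤ t → IsCompactOperator ⇑(V t)) (t : ℝ) (ht : 0 ≤ t) :
    IsCompactOperator ⇑(M.SDop V t) := by
  have := M.cs
  have hV := fun x => normcont_sc hVn x
  have hδ := M.δ_nonneg t ht
  apply clm_compact_closure
  intro η hη
  set ζ := η / (2 * (M.δ t + 1)) with hζ
  have hζ0 : 0 < ζ := by positivity
  obtain ⟨s, φ, hsC, hφc, hφ1, hφ⟩ := hp_schauder (V '' Icc 0 t)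
    (isCompact_Icc.image_of_continuousOn (hVn.mono Icc_subset_Ici_self)) ζ hζ0
  set k : ℝ → ℝ := fun r => max 0 (min r t) with hk
  have hkc : Continuous k := by simp only [hk]; fun_prop
  have hkm : ∀ r, k r ∈ Icc 0 t := fun r => ⟨le_max_left _ _, max_le ht (min_le_right _ _)⟩
  have hkid : ∀ r, 0 ≤ r → r ≤ t → k r = r := fun r h0 h1 => by simp [hk, h0, h1]
  have hVk : Continuous (fun r => V (k r)) :=
    hVn.comp_continuous hkc (fun r => (hkm r).1)
  set Φ : (X₀ →L[ℂ] X) → ℝ → ℝ := fun A r => φ A (V (k r)) with hΦ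
  have hΦc : ∀ A ∈ s, Continuous (Φ A) := fun A hA =>
    (hφc A hA).comp_continuous hVk (fun r => ⟨k r, hkm r, rfl⟩)
  have hcc : ∀ A ∈ s, ∀ y : X, ContinuousOn (fun r => (Φ A r : ℂ) • y) (Ici 0) := by
    intro A hA y
    have := hΦc A hA
    exact Continuous.continuousOn (by fun_prop)
  have hG : ∀ A : s, ∃ G : X →L[ℂ] X₀, ∀ y, G y = M.SD (fun r => (Φ A r : ℂ) • y) t := by
    intro A
    refine ⟨LinearMap.mkContinuous
      { toFun := fun y => M.SD (fun r => (Φ A r : ℂ) • y) t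
        map_add' := ?_
        map_smul' := ?_ } (M.δ t) ?_, fun y => rfl⟩
    · intro y z
      rw [← M.SD_add _ _ (hcc A A.2 y) (hcc A A.2 z) t ht]
      simp only [smul_add]
    · intro a y
      simp only [RingHom.id_apply]
      rw [← M.SD_smul _ (hcc A A.2 y) a t ht]
      congr 1; ext r; rw [smul_comm]
    · intro y
      refine M.SD_le _ (hcc A A.2 y) t ht _ fun r _ _ => ?_
      rw [norm_smul, Complex.norm_real, Real.norm_eq_abs]
      have := hφ1 A A.2 (V (k r)) ⟨k r, hkm r, rfl⟩
      calc _ ≤ 1 * ‖y‖ := mul_le_mul_of_nonneg_right this (norm_nonneg _)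
        _ = _ := one_mul _
  choose G hG using hG
  refine ⟨∑ A : s, (G A).comp A.1, ?_, ?_⟩
  · have : ∀ u : Finset s, IsCompactOperator ⇑(∑ A ∈ u, (G A).comp A.1) := by
      classical
      intro u
      induction u using Finset.induction_on with
      | empty => simpa using isCompactOperator_zero
      | insert A u hA ih =>
        rw [Finset.sum_insert hA]
        obtain ⟨r, hr, hrA⟩ := hsC A.1 A.2
        have h1 : IsCompactOperator ⇑A.1 := hrA ▸ hVc r hr.1
        exact (h1.clm_comp (G A)).add ih
    exact this _
  · have hb : ‖M.SDop V t - ∑ A : s, (G A).comp A.1‖ ≤ M.δ t * ζ := by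
      refine ContinuousLinearMap.opNorm_le_bound _ (mul_nonneg hδ hζ0.le) fun x => ?_
      have e : (∑ A : s, (G A).comp A.1) x =
          M.SD (fun r => ∑ A ∈ s, (Φ A r : ℂ) • A x) t := by
        rw [M.SD_sum s (fun A r => (Φ A r : ℂ) • A x) (fun A hA => hcc A hA _) t ht,
          sum_apply, ← Finset.sum_coe_sort s]
        refine Finset.sum_congr rfl fun A _ => ?_
        rw [ContinuousLinearMap.comp_apply, hG]
      rw [sub_apply, e, M.SDop_apply V hV, mul_assoc]
      refine M.SD_sub_le _ _ (hV x) (continuousOn_finsetSum s fun A hA => hcc A hA _) t ht _ ?_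
      intro r h0 h1
      have h2 := hφ (V r) ⟨r, ⟨h0, h1⟩, rfl⟩
      have h3 := (V r - ∑ c ∈ s, ((φ c (V r) : ℝ) : ℂ) • c).le_of_opNorm_le h2 x
      simp only [sub_apply, sum_apply,
        smul_apply] at h3
      simp only [hΦ, hkid r h0 h1]
      exact h3
    calc _ ≤ _ := hb
      _ ≤ (M.δ t + 1) * ζ := by gcongr; linarith
      _ = η / 2 := by rw [hζ]; field_simp
      _ < η := by linarith

/-- Lemma D. -/
lemma SDop_regular (M : MRSetting X X₀) (V : ℝ → (X₀ →L[ℂ] X))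
    (hV : ∀ x : X₀, ContinuousOn (fun s => V s x) (Ici 0))
    (hVn : ContinuousOn V (Ioi 0)) (hVc : ∀ t, 0 < t → IsCompactOperator ⇑(V t)) :
    ContinuousOn (M.SDop V) (Ioi 0) ∧ ∀ t, 0 < t → IsCompactOperator ⇑(M.SDop V t) := by
  have := M.cs
  have hVε : ∀ ε, 0 < ε → ContinuousOn (fun s => V (ε + s)) (Ici 0) := fun ε hε =>
    hVn.comp (by fun_prop) (fun s (hs : 0 ≤ s) => by simp only [mem_Ioi]; linarith)
  have hdec : ∀ ε t, 0 < ε → ε ≤ t → M.SDop V t =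
      (M.T (t - ε)).comp (M.SDop V ε) + M.SDop (fun s => V (ε + s)) (t - ε) := by
    intro ε t hε ht
    have := M.SDop_shift V hV (t - ε) ε (by linarith) hε.le
    rwa [sub_add_cancel] at this
  have hsmall : ∀ C : ℝ, 0 ≤ C → ∀ η : ℝ, 0 < η → ∀ᶠ ε in 𝓝[>] (0:ℝ),
      C * ‖M.SDop V ε‖ < η := by
    intro C hC η hη
    have := (clm_tendsto_zero.1 (M.SDop_tendsto V hV)).const_mul C
    rw [mul_zero] at this
    exact this.eventually_lt_const hη
  constructor
  · apply clm_contOn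
    intro t (ht : 0 < t) η hη
    obtain ⟨C, hC0, hC⟩ := hp_opbound M.T M.T_cont (2 * t)
    have h2 : ∀ᶠ h in 𝓝[>] (0:ℝ), h < t / 2 :=
      nhdsWithin_le_nhds (eventually_lt_nhds (by positivity))
    obtain ⟨ε, ⟨hε1, hε2⟩, hε0⟩ :=
      (((hsmall C hC0 (η / 4) (by positivity)).and h2).and self_mem_nhdsWithin).exists
    have hε0 : 0 < ε := hε0
    have hc := M.SDop_normcont _ (hVε ε hε0)
    have hca := hc.continuousAt (Ici_mem_nhds (by linarith : 0 < t - ε))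
    obtain ⟨r, hr, hca⟩ := clm_contAt hca (η / 4) (by positivity)
    refine ⟨min r (t / 2), by positivity, fun a ha b hb hat hbt hba => ?_⟩
    rw [lt_min_iff] at hat hbt
    have ha2 := abs_lt.1 hat.2
    have hb2 := abs_lt.1 hbt.2
    rw [hdec ε a hε0 (by linarith), hdec ε b hε0 (by linarith)]
    have e1 : ∀ q, ε ≤ q → q ≤ 2 * t → ‖(M.T (q - ε)).comp (M.SDop V ε)‖ ≤ η / 4 := by
      intro q hq hq2
      refine (ContinuousLinearMap.opNorm_comp_le _ _).trans ?_
      refine le_trans ?_ hε1.le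
      have := hC (q - ε) (by linarith) (by linarith)
      gcongr
    have e2 := hca (a - ε) (by
      rw [show a - ε - (t - ε) = a - t by ring]; exact hat.1)
    have e3 := hca (b - ε) (by
      rw [show b - ε - (t - ε) = b - t by ring]; exact hbt.1)
    have e4 := norm_sub_le_norm_sub_add_norm_sub (M.SDop (fun s => V (ε + s)) (a - ε))
      (M.SDop (fun s => V (ε + s)) (t - ε)) (M.SDop (fun s => V (ε + s)) (b - ε))
    rw [norm_sub_rev (M.SDop (fun s => V (ε + s)) (t - ε))] at e4
    have e5 := e1 a (by linarith) (by linarith)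
    have e6 := e1 b (by linarith) (by linarith)
    rw [add_sub_add_comm]
    refine (norm_add_le _ _).trans ?_
    have e7 := norm_sub_le ((M.T (a - ε)).comp (M.SDop V ε)) ((M.T (b - ε)).comp (M.SDop V ε))
    linarith
  · intro t ht
    obtain ⟨C, hC0, hC⟩ := hp_opbound M.T M.T_cont t
    apply clm_compact_closure
    intro η hη
    have h2 : ∀ᶠ h in 𝓝[>] (0:ℝ), h < t := nhdsWithin_le_nhds (eventually_lt_nhds ht)
    obtain ⟨ε, ⟨hε1, hε2⟩, hε0⟩ := (((hsmall C hC0 η hη).and h2).and self_mem_nhdsWithin).exists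
    have hε0 : 0 < ε := hε0
    refine ⟨M.SDop (fun s => V (ε + s)) (t - ε), ?_, ?_⟩
    · exact M.SDop_compact0 _ (hVε ε hε0) (fun s hs => hVc _ (by linarith)) _ (by linarith)
    · rw [hdec ε t hε0 hε2.le, add_sub_cancel_right]
      refine lt_of_le_of_lt (ContinuousLinearMap.opNorm_comp_le _ _) (lt_of_le_of_lt ?_ hε1)
      have := hC (t - ε) (by linarith) (by linarith)
      gcongr

end MRSetting

namespace MRSetting

lemma L_sc (L : X₀ →L[ℂ] X) {Q : ℝ → (X₀ →L[ℂ] X₀)}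
    (hQ : ∀ x : X₀, ContinuousOn (fun t => Q t x) (Ici 0)) (x : X₀) :
    ContinuousOn (fun s => (L.comp (Q s)) x) (Ici 0) :=
  L.continuous.comp_continuousOn (hQ x)

lemma Bop_apply (M : MRSetting X X₀) (L : X₀ →L[ℂ] X) (Q : ℝ → (X₀ →L[ℂ] X₀))
    (hQ : ∀ x : X₀, ContinuousOn (fun t => Q t x) (Ici 0)) (t : ℝ) (x : X₀) :
    M.Bop L Q t x = M.SD (fun s => L (Q s x)) t :=
  M.SDop_apply _ (L_sc L hQ) t x

lemma Bop_sc (M : MRSetting X X₀) (L : X₀ →L[ℂ] X) (Q : ℝ → (X₀ →L[ℂ] X₀))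
    (hQ : ∀ x : X₀, ContinuousOn (fun t => Q t x) (Ici 0)) (x : X₀) :
    ContinuousOn (fun t => M.Bop L Q t x) (Ici 0) :=
  M.SDop_sc _ (L_sc L hQ) x

lemma Bop_tendsto (M : MRSetting X X₀) (L : X₀ →L[ℂ] X) (Q : ℝ → (X₀ →L[ℂ] X₀))
    (hQ : ∀ x : X₀, ContinuousOn (fun t => Q t x) (Ici 0)) (C η : ℝ) (hη : 0 < η) :
    ∀ᶠ h in 𝓝[>] (0:ℝ), C * ‖M.Bop L Q h‖ < η := by
  have := (clm_tendsto_zero.1 (M.SDop_tendsto _ (L_sc L hQ))).const_mul C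
  rw [mul_zero] at this
  exact this.eventually_lt_const hη

lemma cocycle (M : MRSetting X X₀) (L : X₀ →L[ℂ] X) (Q : ℝ → (X₀ →L[ℂ] X₀))
    (hQ : ∀ x : X₀, ContinuousOn (fun t => Q t x) (Ici 0))
    (hQa : ∀ t s : ℝ, 0 ≤ t → 0 ≤ s → Q (t + s) = (Q t).comp (Q s)) (t s : ℝ) (ht : 0 ≤ t)
    (hs : 0 ≤ s) :
    M.Bop L Q (t + s) = (M.T t).comp (M.Bop L Q s) + (M.Bop L Q t).comp (Q s) := by
  ext x : 1
  simp only [add_apply, ContinuousLinearMap.comp_apply, M.Bop_apply L Q hQ]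
  rw [M.SD_shift (fun r => L (Q r x)) (L_sc L hQ x) t s ht hs]
  congr 1
  refine M.SD_congr _ _ (shift_cont (fun r => L (Q r x)) (L_sc L hQ x) s hs)
    (L_sc L hQ (Q s x)) t ht fun r hr _ => ?_
  rw [add_comm s r, hQa r s hr hs]
  rfl

lemma LE_compact (M : MRSetting X X₀) (L : X₀ →L[ℂ] X) (Q : ℝ → (X₀ →L[ℂ] X₀))
    (hQ : ∀ x : X₀, ContinuousOn (fun t => Q t x) (Ici 0))
    (hQa : ∀ t s : ℝ, 0 ≤ t → 0 ≤ s → Q (t + s) = (Q t).comp (Q s))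
    (hLT : ∀ t : ℝ, 0 < t → IsCompactOperator ⇑(L.comp (M.T t))) (t : ℝ) (ht : 0 < t) :
    IsCompactOperator ⇑(L.comp (M.Bop L Q t)) := by
  have := M.cs
  obtain ⟨C, hC0, hC⟩ := hp_opbound Q hQ t
  apply clm_compact_closure
  intro η hη
  have h2 : ∀ᶠ h in 𝓝[>] (0:ℝ), h < t := nhdsWithin_le_nhds (eventually_lt_nhds ht)
  obtain ⟨ε, ⟨hε1, hε2⟩, hε0⟩ :=
    (((M.Bop_tendsto L Q hQ (‖L‖ * C) η hη).and h2).and self_mem_nhdsWithin).exists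
  have hε0 : 0 < ε := hε0
  refine ⟨(L.comp (M.T ε)).comp (M.Bop L Q (t - ε)), (hLT ε hε0).comp_clm _, ?_⟩
  have e := M.cocycle L Q hQ hQa ε (t - ε) hε0.le (by linarith)
  rw [add_sub_cancel] at e
  rw [e]
  have e2 : L.comp ((M.T ε).comp (M.Bop L Q (t - ε)) + (M.Bop L Q ε).comp (Q (t - ε))) -
      (L.comp (M.T ε)).comp (M.Bop L Q (t - ε)) = L.comp ((M.Bop L Q ε).comp (Q (t - ε))) := by
    ext x : 1
    simp
  rw [e2]
  refine lt_of_le_of_lt ?_ hε1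
  have h3 := hC (t - ε) (by linarith) (by linarith)
  calc _ ≤ ‖L‖ * (‖M.Bop L Q ε‖ * ‖Q (t - ε)‖) :=
        (ContinuousLinearMap.opNorm_comp_le _ _).trans
          (mul_le_mul_of_nonneg_left (ContinuousLinearMap.opNorm_comp_le _ _) L.opNorm_nonneg)
    _ ≤ ‖L‖ * (‖M.Bop L Q ε‖ * C) := by gcongr
    _ = _ := by ring

lemma LE_key (M : MRSetting X X₀) (L : X₀ →L[ℂ] X)
    (p : ℝ) (hp : 1 ≤ p) (Mhat ωhat : ℝ) (hMhat : 0 ≤ Mhat)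
    (hq : ∀ f : ℝ → X, ContinuousOn f (Ici 0) → ∀ t ∈ Ici (0:ℝ),
      ‖M.SD f t‖ ≤ Mhat * (∫ s in (0:ℝ)..t, Real.exp (p * ωhat * (t - s)) * ‖f s‖ ^ p) ^ (1 / p))
    (Q : ℝ → (X₀ →L[ℂ] X₀))
    (hQ : ∀ x : X₀, ContinuousOn (fun t => Q t x) (Ici 0))
    (hQa : ∀ t s : ℝ, 0 ≤ t → 0 ≤ s → Q (t + s) = (Q t).comp (Q s))
    (hLT : ∀ t : ℝ, 0 < t → IsCompactOperator ⇑(L.comp (M.T t)))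
    (hLQ : ∀ t : ℝ, 0 < t → IsCompactOperator ⇑(L.comp (Q t))) (t : ℝ) (ht : 0 < t)
    (η : ℝ) (hη : 0 < η) :
    ∀ᶠ h in 𝓝[>] (0:ℝ), ‖(L.comp (M.Bop L Q t)).comp (Q h - 1)‖ ≤ η := by
  have := M.cs
  set E := M.Bop L Q with hE
  obtain ⟨CT, hCT0, hCT⟩ := hp_opbound M.T M.T_cont (t + 1)
  obtain ⟨CQ, hCQ0, hCQ⟩ := hp_opbound Q hQ (t + 1)
  have h2 : ∀ᶠ h in 𝓝[>] (0:ℝ), h < t / 2 :=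
    nhdsWithin_le_nhds (eventually_lt_nhds (by positivity))
  obtain ⟨ε, ⟨hε1, hε2⟩, hε0⟩ :=
    (((M.Bop_tendsto L Q hQ (‖L‖ * (CT + CQ) * (CQ + 1)) (η / 2) (by positivity)).and h2).and
      self_mem_nhdsWithin).exists
  have hε0 : 0 < ε := hε0
  rw [← hE] at hε1
  set τ := t - 2 * ε with hτ
  have hτ0 : 0 < τ := by linarith
  set r : X₀ →L[ℂ] X := L.comp ((M.T (t - ε)).comp (E ε)) + L.comp ((E ε).comp (Q (t - ε))) with hr
  have hdec : ∀ y, L (E t y) = (L.comp (M.T ε)) (E τ (Q ε y)) + r y := by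
    intro y
    have e1 := M.cocycle L Q hQ hQa ε (t - ε) hε0.le (by linarith)
    have e2 := M.cocycle L Q hQ hQa τ ε hτ0.le hε0.le
    have e3 := M.T_add ε τ hε0.le hτ0.le
    rw [add_sub_cancel] at e1
    rw [show τ + ε = t - ε by rw [hτ]; ring] at e2
    rw [show ε + τ = t - ε by rw [hτ]; ring] at e3
    rw [← hE] at e1 e2
    rw [e1]
    simp only [add_apply, ContinuousLinearMap.comp_apply, hr, e3, e2, map_add]
    abel
  have hrn : ‖r‖ * (CQ + 1) ≤ η / 2 := by
    have e1 : ‖r‖ ≤ ‖L‖ * (CT + CQ) * ‖E ε‖ := by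
      rw [hr]
      refine (norm_add_le (L.comp ((M.T (t - ε)).comp (E ε)))
        (L.comp ((E ε).comp (Q (t - ε))))).trans ?_
      have a1 := hCT (t - ε) (by linarith) (by linarith)
      have a2 := hCQ (t - ε) (by linarith) (by linarith)
      have b1 : ‖L.comp ((M.T (t - ε)).comp (E ε))‖ ≤ ‖L‖ * (CT * ‖E ε‖) := by
        refine (ContinuousLinearMap.opNorm_comp_le _ _).trans ?_
        gcongr
        refine (ContinuousLinearMap.opNorm_comp_le _ _).trans ?_
        gcongr
      have b2 : ‖L.comp ((E ε).comp (Q (t - ε)))‖ ≤ ‖L‖ * (‖E ε‖ * CQ) := by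
        refine (ContinuousLinearMap.opNorm_comp_le _ _).trans ?_
        gcongr
        refine (ContinuousLinearMap.opNorm_comp_le _ _).trans ?_
        gcongr
      calc _ ≤ _ := add_le_add b1 b2
        _ = _ := by ring
    calc _ ≤ ‖L‖ * (CT + CQ) * ‖E ε‖ * (CQ + 1) := by gcongr
      _ = ‖L‖ * (CT + CQ) * (CQ + 1) * ‖E ε‖ := by ring
      _ ≤ _ := hε1.le
  obtain ⟨C, hC, hKC⟩ := (hLQ ε hε0).image_subset_compact_of_bounded
    (f := (L.comp (Q ε) : X₀ →ₗ[ℂ] X))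
    (Metric.isBounded_closedBall (x := (0:X₀)) (r := CQ))
  have h1 : ∀ᶠ h in 𝓝[>] (0:ℝ), h < 1 := nhdsWithin_le_nhds (eventually_lt_nhds one_pos)
  filter_upwards [M.compact_shift p hp Mhat ωhat hMhat hq (L.comp (M.T ε)) (hLT ε hε0) C hC τ hτ0.le
    (η / 2) (by positivity), h1, self_mem_nhdsWithin] with h hh hh1 hh0
  have hh0 : 0 < h := hh0
  refine ContinuousLinearMap.opNorm_le_of_unit_norm hη.le fun x hx => ?_
  set k : ℝ → ℝ := fun r => max 0 (min r (t + 1)) with hk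
  have hkc : Continuous k := by simp only [hk]; fun_prop
  have hkm : ∀ r, k r ∈ Icc 0 (t + 1) :=
    fun r => ⟨le_max_left _ _, max_le (by linarith) (min_le_right _ _)⟩
  have hkid : ∀ r, 0 ≤ r → r ≤ t + 1 → k r = r := fun r h0 h1 => by simp [hk, h0, h1]
  set f : ℝ → X := fun s => (L.comp (Q ε)) (Q (k s) x) with hf
  have hfc : Continuous f :=
    (L.comp (Q ε)).continuous.comp ((hQ x).comp_continuous hkc (fun r => (hkm r).1))
  have hfC : ∀ s, f s ∈ C := by
    intro s
    apply hKC
    refine ⟨Q (k s) x, ?_, rfl⟩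
    rw [mem_closedBall_zero_iff]
    have := (Q (k s)).le_of_opNorm_le (hCQ _ (hkm s).1 (hkm s).2) x
    rwa [hx, mul_one] at this
  have hcomm : ∀ a b, 0 ≤ a → 0 ≤ b → ∀ y, Q a (Q b y) = Q (a + b) y := by
    intro a b ha hb y
    rw [hQa a b ha hb]; rfl
  have e : M.SD (fun s => f (s + h) - f s) τ = E τ (Q ε (Q h x - x)) := by
    rw [hE, M.Bop_apply L Q hQ]
    refine M.SD_congr _ _ (Continuous.continuousOn (by fun_prop)) (L_sc L hQ _) τ hτ0.le ?_
    intro s hs hsτ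
    simp only [hf]
    rw [hkid s hs (by linarith), hkid (s + h) (by linarith) (by linarith)]
    simp only [ContinuousLinearMap.comp_apply, map_sub]
    rw [hcomm ε (s + h) hε0.le (by linarith), hcomm ε s hε0.le hs, hcomm ε h hε0.le hh0.le,
      hcomm s _ hs (by linarith), hcomm s ε hs hε0.le, show s + (ε + h) = ε + (s + h) by ring,
      add_comm s ε]
  have e1 := hh f hfc hfC
  rw [e] at e1
  have e2 : ‖Q h x - x‖ ≤ CQ + 1 := by
    have := (Q h).le_of_opNorm_le (hCQ h hh0.le (by linarith)) x
    rw [hx, mul_one] at this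
    refine (norm_sub_le _ _).trans ?_
    rw [hx]
    linarith
  have e3 : ‖r (Q h x - x)‖ ≤ η / 2 :=
    ((r.le_opNorm _).trans (mul_le_mul_of_nonneg_left e2 r.opNorm_nonneg)).trans hrn
  change ‖L (E t (Q h x - x))‖ ≤ η
  rw [hdec]
  refine (norm_add_le _ _).trans ?_
  linarith

lemma LE_normcont (M : MRSetting X X₀) (L : X₀ →L[ℂ] X)
    (p : ℝ) (hp : 1 ≤ p) (Mhat ωhat : ℝ) (hMhat : 0 ≤ Mhat)
    (hq : ∀ f : ℝ → X, ContinuousOn f (Ici 0) → ∀ t ∈ Ici (0:ℝ),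
      ‖M.SD f t‖ ≤ Mhat * (∫ s in (0:ℝ)..t, Real.exp (p * ωhat * (t - s)) * ‖f s‖ ^ p) ^ (1 / p))
    (Q : ℝ → (X₀ →L[ℂ] X₀))
    (hQ : ∀ x : X₀, ContinuousOn (fun t => Q t x) (Ici 0))
    (hQa : ∀ t s : ℝ, 0 ≤ t → 0 ≤ s → Q (t + s) = (Q t).comp (Q s))
    (hLT : ∀ t : ℝ, 0 < t → IsCompactOperator ⇑(L.comp (M.T t)))
    (hLQ : ∀ t : ℝ, 0 < t → IsCompactOperator ⇑(L.comp (Q t))) :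
    ContinuousOn (fun t => L.comp (M.Bop L Q t)) (Ioi 0) := by
  have := M.cs
  apply clm_contOn
  intro t (ht : 0 < t) η hη
  set E := M.Bop L Q with hE
  obtain ⟨CT, hCT0, hCT⟩ := hp_opbound M.T M.T_cont (t + 1)
  obtain ⟨CQ, hCQ0, hCQ⟩ := hp_opbound Q hQ (t + 1)
  have hl := M.Bop_tendsto L Q hQ (‖L‖ * CT * (CQ + 1)) (η / 4) (by positivity)
  rw [eventually_nhdsWithin_iff, Metric.eventually_nhds_iff] at hl
  obtain ⟨ρ, hρ, hl⟩ := hl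
  have hEs : ∀ q, 0 < q → q < ρ → ‖L‖ * CT * (CQ + 1) * ‖E q‖ ≤ η / 4 := fun q h0 h1 =>
    (hl (y := q) (by rw [Real.dist_eq, sub_zero, abs_of_pos h0]; exact h1) h0).le
  set ρ' := min (min (ρ / 2) (1 / 2)) (t / 2) with hρ'
  have hρ'0 : 0 < ρ' := by positivity
  have hρ'1 : ρ' ≤ ρ / 2 := (min_le_left _ _).trans (min_le_left _ _)
  have hρ'2 : ρ' ≤ 1 / 2 := (min_le_left _ _).trans (min_le_right _ _)
  have hρ'3 : ρ' ≤ t / 2 := min_le_right _ _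
  set t' := t - ρ' with ht'
  have ht'0 : 0 < t' := by linarith
  have hk := M.LE_key L p hp Mhat ωhat hMhat hq Q hQ hQa hLT hLQ t' ht'0 (η / (4 * (CQ + 1)))
    (by positivity)
  rw [eventually_nhdsWithin_iff, Metric.eventually_nhds_iff] at hk
  obtain ⟨r, hr, hk⟩ := hk
  refine ⟨min (ρ' / 2) (r / 2), by positivity, fun a ha b hb hat hbt hba => ?_⟩
  simp only [lt_min_iff, abs_lt] at hat hbt
  have hb : 0 < b := hb
  obtain ⟨h, rfl⟩ : ∃ h, a = b + h := ⟨a - b, by ring⟩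
  obtain ⟨q, rfl⟩ : ∃ q, b = t' + q := ⟨b - t', by ring⟩
  have hh : 0 < h := by linarith
  have hhr : h < r := by linarith [hat.2.2, hbt.2.1]
  have hhρ : h < ρ' := by linarith [hat.1.2, hbt.1.1]
  have hq0 : 0 < q := by linarith [hbt.1.1]
  have hq1 : q < ρ := by linarith [hbt.1.2]
  have hq2 : q < 1 := by linarith [hbt.1.2]
  have hkh := hk (y := h) (by rw [Real.dist_eq, sub_zero, abs_of_pos hh]; exact hhr) hh
  rw [← hE] at hkh
  have hTb := hCT (t' + q) (by linarith) (by linarith [hbt.1.2])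
  have hTt := hCT t' (by linarith) (by linarith)
  have hQq := hCQ q hq0.le (by linarith)
  have hQh := hCQ h hh.le (by linarith)
  have hQ1 : ‖Q h - 1‖ ≤ CQ + 1 := by
    refine (norm_sub_le (Q h) 1).trans ?_
    have : ‖(1 : X₀ →L[ℂ] X₀)‖ ≤ 1 := ContinuousLinearMap.norm_id_le
    linarith
  have e1 := M.cocycle L Q hQ hQa (t' + q) h hb.le hh.le
  have e2 := M.cocycle L Q hQ hQa t' q ht'0.le hq0.le
  rw [← hE] at e1 e2
  have e3 : L.comp (E (t' + q + h)) - L.comp (E (t' + q)) =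
      L.comp ((M.T (t' + q)).comp (E h)) + (L.comp ((M.T t').comp (E q))).comp (Q h - 1) +
      ((L.comp (E t')).comp (Q h - 1)).comp (Q q) := by
    have hc : (Q h).comp (Q q) = (Q q).comp (Q h) := by
      rw [← hQa h q hh.le hq0.le, ← hQa q h hq0.le hh.le, add_comm]
    rw [e1]
    ext x : 1
    have hcx : Q h (Q q x) = Q q (Q h x) := congrArg (fun A : X₀ →L[ℂ] X₀ => A x) hc
    simp only [sub_apply, add_apply, ContinuousLinearMap.comp_apply, map_add, map_sub, e2, hcx,
      one_apply_eq_self]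
    abel
  rw [e3]
  have n1 : ‖L.comp ((M.T (t' + q)).comp (E h))‖ ≤ η / 4 := by
    refine (ContinuousLinearMap.opNorm_comp_le _ _).trans ?_
    calc _ ≤ ‖L‖ * (‖M.T (t' + q)‖ * ‖E h‖) := by
          gcongr
          exact ContinuousLinearMap.opNorm_comp_le _ _
      _ ≤ ‖L‖ * (CT * ‖E h‖) := by gcongr
      _ = ‖L‖ * CT * 1 * ‖E h‖ := by ring
      _ ≤ ‖L‖ * CT * (CQ + 1) * ‖E h‖ := by gcongr; linarith
      _ ≤ _ := hEs h hh (by linarith)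
  have n2 : ‖(L.comp ((M.T t').comp (E q))).comp (Q h - 1)‖ ≤ η / 4 := by
    refine (ContinuousLinearMap.opNorm_comp_le _ _).trans ?_
    calc _ ≤ (‖L‖ * (CT * ‖E q‖)) * (CQ + 1) := by
          gcongr
          refine (ContinuousLinearMap.opNorm_comp_le _ _).trans ?_
          gcongr
          refine (ContinuousLinearMap.opNorm_comp_le _ _).trans ?_
          gcongr
      _ = ‖L‖ * CT * (CQ + 1) * ‖E q‖ := by ring
      _ ≤ _ := hEs q hq0 hq1
  have n3 : ‖((L.comp (E t')).comp (Q h - 1)).comp (Q q)‖ ≤ η / 4 := by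
    refine (ContinuousLinearMap.opNorm_comp_le _ _).trans ?_
    calc _ ≤ η / (4 * (CQ + 1)) * CQ := by gcongr
      _ ≤ η / (4 * (CQ + 1)) * (CQ + 1) := by gcongr; linarith
      _ = η / 4 := by field_simp
  refine (norm_add_le (L.comp ((M.T (t' + q)).comp (E h)) +
    (L.comp ((M.T t').comp (E q))).comp (Q h - 1))
    (((L.comp (E t')).comp (Q h - 1)).comp (Q q))).trans ?_
  have := norm_add_le (L.comp ((M.T (t' + q)).comp (E h)))
    ((L.comp ((M.T t').comp (E q))).comp (Q h - 1))
  linarith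

lemma uniq (M : MRSetting X X₀) (L : X₀ →L[ℂ] X) (w : ℝ → X₀) (hw : ContinuousOn w (Ici 0))
    (hfix : ∀ t, 0 ≤ t → w t = M.SD (fun s => L (w s)) t) (t : ℝ) (ht : 0 ≤ t) : w t = 0 := by
  have hl : ∀ᶠ h in 𝓝[>] (0:ℝ), M.δ h * ‖L‖ < 1 / 2 := by
    have := M.δ_lim.mul_const ‖L‖
    rw [zero_mul] at this
    exact this.eventually_lt_const (by norm_num)
  obtain ⟨r, hr1, hr0⟩ := (hl.and self_mem_nhdsWithin).exists
  have hr0 : 0 < r := hr0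
  have step : ∀ w : ℝ → X₀, ContinuousOn w (Ici 0) →
      (∀ t, 0 ≤ t → w t = M.SD (fun s => L (w s)) t) → ∀ t, 0 ≤ t → t ≤ r → w t = 0 := by
    intro w hw hfix
    obtain ⟨m, hm, hmax⟩ := (isCompact_Icc (a := (0:ℝ)) (b := r)).exists_isMaxOn
      ⟨0, le_rfl, hr0.le⟩ ((hw.mono Icc_subset_Ici_self).norm)
    have hmm : ∀ s, 0 ≤ s → s ≤ r → ‖w s‖ ≤ ‖w m‖ := fun s h0 h1 => hmax ⟨h0, h1⟩
    have h1 : ‖w m‖ ≤ M.δ m * (‖L‖ * ‖w m‖) := by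
      conv_lhs => rw [hfix m hm.1]
      refine M.SD_le _ (L.continuous.comp_continuousOn hw) m hm.1 _ fun s h0 h1 => ?_
      exact (L.le_opNorm _).trans
        (mul_le_mul_of_nonneg_left (hmm s h0 (h1.trans hm.2)) L.opNorm_nonneg)
    have h2 : M.δ m ≤ M.δ r := M.δ_mono hm.1 hr0.le hm.2
    have h3 : M.δ m * (‖L‖ * ‖w m‖) ≤ 1 / 2 * ‖w m‖ := by
      calc _ ≤ M.δ r * (‖L‖ * ‖w m‖) := by gcongr
        _ = (M.δ r * ‖L‖) * ‖w m‖ := by ring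
        _ ≤ _ := by gcongr
    have h4 : ‖w m‖ ≤ 0 := by linarith
    intro s h0 h1
    exact norm_le_zero_iff.1 ((hmm s h0 h1).trans h4)
  have ind : ∀ n : ℕ, ∀ w : ℝ → X₀, ContinuousOn w (Ici 0) →
      (∀ t, 0 ≤ t → w t = M.SD (fun s => L (w s)) t) → ∀ t, 0 ≤ t → t ≤ n * r → w t = 0 := by
    intro n
    induction n with
    | zero =>
      intro w hw hfix t h0 h1
      exact step w hw hfix t h0 (by simp at h1; linarith)
    | succ n ih =>
      intro w hw hfix t h0 h1
      rcases le_total t r with h2 | h2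
      · exact step w hw hfix t h0 h2
      · have := ih (fun s => w (r + s)) (shift_cont w hw r hr0.le) (by
          intro s hs
          have e := M.SD_shift (fun s => L (w s)) (L.continuous.comp_continuousOn hw) s r hs hr0.le
          rw [← hfix r hr0.le, step w hw hfix r hr0.le le_rfl, map_zero, zero_add] at e
          rw [← e, add_comm r s]
          exact hfix _ (by linarith)) (t - r) (by linarith) (by push_cast at h1; linarith)
        simpa using this
  obtain ⟨n, hn⟩ := exists_nat_gt (t / r)
  refine ind n w hw hfix t ht ?_
  rw [div_lt_iff₀ hr0] at hn
  exact hn.le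

lemma R_add (M : MRSetting X X₀) (L : X₀ →L[ℂ] X) (R : ℝ → (X₀ →L[ℂ] X₀))
    (hRsc : ∀ x : X₀, ContinuousOn (fun t => R t x) (Ici 0))
    (hRfix : ∀ t ∈ Ici (0:ℝ), R t = M.T t + M.Bop L R t) (t s : ℝ) (ht : 0 ≤ t) (hs : 0 ≤ s) :
    R (t + s) = (R t).comp (R s) := by
  ext x : 1
  have hc1 : ContinuousOn (fun r => R (s + r) x) (Ici 0) :=
    shift_cont (fun r => R r x) (hRsc x) s hs
  have hc2 := hRsc (R s x)
  have hR : ∀ t, 0 ≤ t → ∀ x, R t x = M.T t x + M.SD (fun r => L (R r x)) t := by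
    intro t ht x
    conv_lhs => rw [hRfix t ht]
    rw [add_apply, M.Bop_apply L R hRsc]
  have := M.uniq L (fun r => R (s + r) x - R r (R s x)) (hc1.sub hc2) (by
    intro t ht
    simp only [map_sub]
    rw [M.SD_sub (fun r => L (R (s + r) x)) (fun r => L (R r (R s x)))
      (L.continuous.comp_continuousOn hc1) (L.continuous.comp_continuousOn hc2) t ht]
    have e : M.T t (R s x) = M.T t (M.T s x) + M.T t (M.SD (fun r => L (R r x)) s) := by
      rw [← map_add, ← hR s hs x]
    rw [hR (s + t) (by linarith), hR t ht (R s x), add_comm s t,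
      M.SD_shift (fun r => L (R r x)) (L_sc L hRsc x) t s ht hs, M.T_add t s ht hs, e,
      ContinuousLinearMap.comp_apply]
    abel) t ht
  rw [sub_eq_zero] at this
  rw [add_comm t s]
  exact this

end MRSetting

end helpers

/-- for a `p`-quasi Hille–Yosida operator, compactness of `L ∘ T₀` makes `S₂`
norm continuous and compact on `(0,∞)`, and eventual norm continuity / compactness
are preserved under the perturbation. -/
theorem S2_regularity_quasiHY (M : MRSetting X X₀) (L : X₀ →L[ℂ] X)
    (R : ℝ → (X₀ →L[ℂ] X₀))
    (hRsc : ∀ x : X₀, ContinuousOn (fun t => R t x) (Ici 0))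
    (hRfix : ∀ t ∈ Ici (0:ℝ), R t = M.T t + M.Bop L R t)
    (p : ℝ) (hp : 1 ≤ p) (Mhat ωhat : ℝ) (hMhat : 0 ≤ Mhat)
    (hq : ∀ f : ℝ → X, ContinuousOn f (Ici 0) → ∀ t ∈ Ici (0:ℝ),
      ‖M.SD f t‖ ≤ Mhat * (∫ s in (0:ℝ)..t, Real.exp (p * ωhat * (t - s)) * ‖f s‖ ^ p) ^ (1 / p))
    (hLT : ∀ t : ℝ, 0 < t → IsCompactOperator ⇑(L.comp (M.T t))) :
    ContinuousOn ((M.Bop L)^[2] M.T) (Ioi 0) ∧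
    (∀ t : ℝ, 0 < t → IsCompactOperator ⇑((M.Bop L)^[2] M.T t)) ∧
    (∀ t : ℝ, 0 < t → IsCompactOperator ⇑(L.comp (R t))) ∧
    ((∃ t₀ : ℝ, 0 ≤ t₀ ∧ ContinuousOn M.T (Ioi t₀)) ↔
      (∃ t₁ : ℝ, 0 ≤ t₁ ∧ ContinuousOn R (Ioi t₁))) ∧
    ((∃ t₀ : ℝ, 0 ≤ t₀ ∧ ∀ t : ℝ, t₀ < t → IsCompactOperator ⇑(M.T t)) ↔
      (∃ t₁ : ℝ, 0 ≤ t₁ ∧ ∀ t : ℝ, t₁ < t → IsCompactOperator ⇑(R t))) := by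

  have hTsc := M.T_cont
  have hTa := M.T_add
  have hRa := M.R_add L R hRsc hRfix
  set S1 := M.Bop L M.T with hS1
  set R1 := M.Bop L R with hR1
  set R2 := M.Bop L R1 with hR2
  have hS1sc := M.Bop_sc L M.T hTsc
  have hR1sc := M.Bop_sc L R hRsc
  have hLR1c : ∀ t, 0 < t → IsCompactOperator ⇑(L.comp (R1 t)) :=
    fun t ht => M.LE_compact L R hRsc hRa hLT t ht
  have hLR : ∀ t : ℝ, 0 < t → IsCompactOperator ⇑(L.comp (R t)) := by
    intro t ht
    rw [hRfix t ht.le, ContinuousLinearMap.comp_add]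
    exact (hLT t ht).add (hLR1c t ht)
  have hLS1n : ContinuousOn (fun t => L.comp (S1 t)) (Ioi 0) :=
    M.LE_normcont L p hp Mhat ωhat hMhat hq M.T hTsc hTa hLT hLT
  have hLR1n : ContinuousOn (fun t => L.comp (R1 t)) (Ioi 0) :=
    M.LE_normcont L p hp Mhat ωhat hMhat hq R hRsc hRa hLT hLR
  obtain ⟨hS2n, hS2c⟩ := M.SDop_regular (fun t => L.comp (S1 t)) (MRSetting.L_sc L hS1sc) hLS1n
    (fun t ht => M.LE_compact L M.T hTsc hTa hLT t ht)
  obtain ⟨hR2n, hR2c⟩ := M.SDop_regular (fun t => L.comp (R1 t)) (MRSetting.L_sc L hR1sc) hLR1n hLR1c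
  have hR2n : ContinuousOn R2 (Ioi 0) := hR2n
  have hR2c : ∀ t, 0 < t → IsCompactOperator ⇑(R2 t) := hR2c
  have hR1dec : ∀ t, 0 ≤ t → R1 t = S1 t + R2 t := by
    intro t ht
    ext1 x
    rw [add_apply, hR1, hS1, hR2, M.Bop_apply L R hRsc, M.Bop_apply L M.T hTsc,
      M.Bop_apply L R1 hR1sc,
      ← M.SD_add (fun s => L (M.T s x)) (fun s => L (R1 s x)) (MRSetting.L_sc L hTsc x) (MRSetting.L_sc L hR1sc x) t ht]
    refine M.SD_congr _ _ (MRSetting.L_sc L hRsc x)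
      ((MRSetting.L_sc L hTsc x).add (MRSetting.L_sc L hR1sc x)) t ht fun s hs _ => ?_
    change L (R s x) = L (M.T s x) + L (R1 s x)
    rw [← map_add, ← add_apply, ← hRfix s hs]
  have hRdec : ∀ t, 0 ≤ t → R t = M.T t + S1 t + R2 t := by
    intro t ht
    rw [hRfix t ht, hR1dec t ht, add_assoc]
  have hcoc : ∀ t s, 0 ≤ t → 0 ≤ s → S1 (t + s) = (M.T t).comp (S1 s) + (S1 t).comp (M.T s) :=
    fun t s ht hs => M.cocycle L M.T hTsc hTa t s ht hs
  refine ⟨hS2n, hS2c, hLR, ⟨?_, ?_⟩, ⟨?_, ?_⟩⟩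
  · rintro ⟨t₀, ht₀, hT⟩
    set s := t₀ + 1 with hs
    refine ⟨t₀ + s, by linarith, ?_⟩
    have hLTs : ContinuousOn (fun r => L.comp (M.T (s + r))) (Ici 0) :=
      continuousOn_const.clm_comp (hT.comp (by fun_prop)
        (fun r (hr : 0 ≤ r) => by simp only [mem_Ioi]; linarith))
    have hc := M.SDop_normcont _ hLTs
    have hsub : ∀ u ∈ Ioi (t₀ + s), u - s ∈ Ioi t₀ := fun u (hu : t₀ + s < u) => by
      simp only [mem_Ioi]; linarith
    have h1 : ContinuousOn (fun u => (M.T (u - s)).comp (S1 s)) (Ioi (t₀ + s)) :=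
      (hT.comp (by fun_prop) hsub).clm_comp continuousOn_const
    have h2 : ContinuousOn (fun u => M.SDop (fun r => L.comp (M.T (s + r))) (u - s))
        (Ioi (t₀ + s)) :=
      hc.comp (by fun_prop) (fun u hu => ht₀.trans (le_of_lt (hsub u hu)))
    have h3 : ContinuousOn M.T (Ioi (t₀ + s)) :=
      hT.mono (Ioi_subset_Ioi (by linarith))
    have h4 : ContinuousOn R2 (Ioi (t₀ + s)) :=
      hR2n.mono (Ioi_subset_Ioi (by linarith))
    refine ((h3.add (h1.add h2)).add h4).congr fun u hu => ?_
    have hu' : t₀ < u - s := hsub u hu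
    have e := M.SDop_shift _ (MRSetting.L_sc L hTsc) (u - s) s (by linarith) (by linarith)
    rw [sub_add_cancel] at e
    rw [hRdec u (by linarith)]
    have e : S1 u = (M.T (u - s)).comp (S1 s) +
      M.SDop (fun r => L.comp (M.T (s + r))) (u - s) := e
    rw [e]
    rfl
  · rintro ⟨t₁, ht₁, hR⟩
    set s := t₁ + 1 with hs
    refine ⟨t₁ + s, by linarith, ?_⟩
    have hLRs : ContinuousOn (fun r => L.comp (R (s + r))) (Ici 0) :=
      continuousOn_const.clm_comp (hR.comp (by fun_prop)
        (fun r (hr : 0 ≤ r) => by simp only [mem_Ioi]; linarith))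
    have hLR1s : ContinuousOn (fun r => L.comp (R1 (s + r))) (Ici 0) :=
      hLR1n.comp (f := fun r => s + r) (by fun_prop)
        (fun r (hr : 0 ≤ r) => by simp only [mem_Ioi]; linarith)
    have hc := M.SDop_normcont _ hLRs
    have hc1 := M.SDop_normcont _ hLR1s
    have hsub : ∀ u ∈ Ioi (t₁ + s), u - s ∈ Ioi t₁ := fun u (hu : t₁ + s < u) => by
      simp only [mem_Ioi]; linarith
    have hsub0 : ∀ u ∈ Ioi (t₁ + s), u - s ∈ Ioi 0 := fun u hu => lt_of_le_of_lt ht₁ (hsub u hu)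
    have h1 : ContinuousOn (fun u => M.SDop (fun r => L.comp (R (s + r))) (u - s))
        (Ioi (t₁ + s)) :=
      hc.comp (by fun_prop) (fun u hu => mem_Ici.2 (le_of_lt (mem_Ioi.1 (hsub0 u hu))))
    have h2 : ContinuousOn (fun u => M.SDop (fun r => L.comp (R1 (s + r))) (u - s))
        (Ioi (t₁ + s)) :=
      hc1.comp (by fun_prop) (fun u hu => mem_Ici.2 (le_of_lt (mem_Ioi.1 (hsub0 u hu))))
    have h3 : ContinuousOn (fun u => (R (u - s) - R2 (u - s)).comp (M.T s)) (Ioi (t₁ + s)) :=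
      ((hR.comp (by fun_prop) hsub).sub (hR2n.comp (by fun_prop) hsub0)).clm_comp
        continuousOn_const
    refine ((h2.sub h1).add h3).congr fun u hu => ?_
    have hu' : t₁ < u - s := hsub u hu
    obtain ⟨t, rfl⟩ : ∃ t, u = t + s := ⟨u - s, by ring⟩
    rw [add_sub_cancel_right] at hu'
    have ht : 0 ≤ t := by linarith
    have hs0 : 0 ≤ s := by linarith
    have e1 : R1 (t + s) = (M.T t).comp (R1 s) + M.SDop (fun r => L.comp (R (s + r))) t :=
      M.SDop_shift _ (MRSetting.L_sc L hRsc) t s ht hs0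
    have e2 : R2 (t + s) = (M.T t).comp (R2 s) + M.SDop (fun r => L.comp (R1 (s + r))) t :=
      M.SDop_shift _ (MRSetting.L_sc L hR1sc) t s ht hs0
    have e3 := hcoc t s ht hs0
    simp only [Pi.add_apply, Pi.sub_apply, add_sub_cancel_right]
    have e4 : M.SDop (fun r => L.comp (R (s + r))) t = R1 (t + s) - (M.T t).comp (R1 s) := by
      rw [e1]; abel
    have e5 : M.SDop (fun r => L.comp (R1 (s + r))) t = R2 (t + s) - (M.T t).comp (R2 s) := by
      rw [e2]; abel
    have e6 : R t - R2 t = M.T t + S1 t := by rw [hRdec t ht]; abel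
    rw [e4, e5, e6, hR1dec (t + s) (by linarith), hR1dec s hs0, e3, hTa t s ht hs0,
      ContinuousLinearMap.comp_add, ContinuousLinearMap.add_comp]
    abel
  · rintro ⟨t₀, ht₀, hT⟩
    refine ⟨2 * t₀, by linarith, fun t ht => ?_⟩
    have hh : t₀ < t / 2 := by linarith
    have e := hcoc (t / 2) (t / 2) (by linarith) (by linarith)
    rw [add_halves] at e
    rw [hRdec t (by linarith), e]
    exact ((hT t (by linarith)).add (((hT _ hh).comp_clm _).add ((hT _ hh).clm_comp _))).add
      (hR2c t (by linarith))
  · rintro ⟨t₁, ht₁, hR⟩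
    refine ⟨2 * t₁, by linarith, fun t ht => ?_⟩
    have hP : ∀ t, t₁ < t → IsCompactOperator ⇑(M.T t + S1 t) := by
      intro t ht
      have e6 : M.T t + S1 t = R t - R2 t := by rw [hRdec t (by linarith)]; abel
      rw [e6]
      exact (hR t ht).sub (hR2c t (by linarith))
    have hh : t₁ < t / 2 := by linarith
    have e := hcoc (t / 2) (t / 2) (by linarith) (by linarith)
    have e' := hTa (t / 2) (t / 2) (by linarith) (by linarith)
    rw [add_halves] at e e'
    have e7 : M.T t = (M.T (t / 2)).comp (M.T (t / 2) + S1 (t / 2)) +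
        (M.T (t / 2) + S1 (t / 2)).comp (M.T (t / 2)) - (M.T t + S1 t) := by
      rw [e, e', ContinuousLinearMap.comp_add, ContinuousLinearMap.add_comp]
      abel
    rw [e7]
    exact (((hP _ hh).clm_comp _).add ((hP _ hh).comp_clm _)).sub (hP t (by linarith))

end
end

section
/- Let f_j : [0,∞) → [0,∞) (j = 0, 1, 2, …) be functions, each bounded on every compact interval, satisfying f_j(t+s) ≤ Σ_{k=0}^{j} f_k(t)·f_{j−k}(s) for all t, s > 0 and every j ≥ 0. Let γ ∈ ℝ be such that there exist γ' < γ and M ≥ 0 with f₀(t) ≤ M e^{γ' t} for all t ≥ 0. Then for every j ≥ 0 there exists M_j ≥ 0 such that f_j(t) ≤ M_j e^{γ t} for all t ≥ 0. -/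
open Set Filter
open scoped Topology

/-- exponential bounds for a subconvolutive family of nonnegative functions. -/
theorem subconvolutive_exponential_bound (f : ℕ → ℝ → ℝ)
    (hnonneg : ∀ j : ℕ, ∀ t : ℝ, 0 ≤ t → 0 ≤ f j t)
    (hbdd : ∀ j : ℕ, ∀ b : ℝ, 0 ≤ b → ∃ C : ℝ, ∀ t ∈ Icc (0:ℝ) b, f j t ≤ C)
    (hsub : ∀ j : ℕ, ∀ t s : ℝ, 0 < t → 0 < s →
      f j (t + s) ≤ ∑ k ∈ Finset.range (j + 1), f k t * f (j - k) s)
    (γ : ℝ)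
    (hγ : ∃ γ' : ℝ, γ' < γ ∧ ∃ M : ℝ, 0 ≤ M ∧ ∀ t : ℝ, 0 ≤ t → f 0 t ≤ M * Real.exp (γ' * t)) :
    ∀ j : ℕ, ∃ Mj : ℝ, 0 ≤ Mj ∧ ∀ t : ℝ, 0 ≤ t → f j t ≤ Mj * Real.exp (γ * t) := by
  obtain ⟨γ', hlt, M, hM, hf0⟩ := hγ
  -- choose a step T with f 0 T small
  obtain ⟨T, hT, hsmall⟩ : ∃ T : ℝ, 0 < T ∧ f 0 T ≤ 1 / 2 * Real.exp (γ * T) := by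
    have hpos : 0 < γ - γ' := by linarith
    refine ⟨(2 * M + 1) / (γ - γ'), by positivity, ?_⟩
    set T := (2 * M + 1) / (γ - γ') with hTdef
    have hT : 0 < T := by positivity
    have h1 : (γ - γ') * T = 2 * M + 1 := by rw [hTdef]; field_simp
    have h2 : 2 * M ≤ Real.exp ((γ - γ') * T) := by
      have := Real.add_one_le_exp ((γ - γ') * T)
      linarith
    have h3 : Real.exp (γ * T) = Real.exp ((γ - γ') * T) * Real.exp (γ' * T) := by
      rw [← Real.exp_add]; congr 1; ring
    have h4 := hf0 T hT.le
    have h5 := mul_le_mul_of_nonneg_right h2 (Real.exp_pos (γ' * T)).le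
    rw [h3]; linarith
  intro j
  induction j using Nat.strong_induction_on with
  | _ j ih =>
  rcases Nat.eq_zero_or_pos j with rfl | hj
  · refine ⟨M, hM, fun t ht => (hf0 t ht).trans ?_⟩
    have : γ' * t ≤ γ * t := mul_le_mul_of_nonneg_right hlt.le ht
    gcongr
  have ih' : ∀ m : ℕ, ∃ Mm : ℝ, 0 ≤ Mm ∧ (m < j → ∀ t : ℝ, 0 ≤ t →
      f m t ≤ Mm * Real.exp (γ * t)) := by
    intro m
    by_cases hm : m < j
    · obtain ⟨Mm, h0, h⟩ := ih m hm
      exact ⟨Mm, h0, fun _ => h⟩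
    · exact ⟨0, le_rfl, fun h => absurd h hm⟩
  choose N hN0 hN using ih'
  obtain ⟨K, hK0, hK⟩ : ∃ K : ℝ, 0 ≤ K ∧ ∀ s : ℝ, 0 ≤ s →
      ∑ k ∈ Finset.range j, f (k + 1) T * f (j - (k + 1)) s ≤ K * Real.exp (γ * s) := by
    refine ⟨∑ k ∈ Finset.range j, f (k + 1) T * N (j - (k + 1)),
      Finset.sum_nonneg fun k _ => mul_nonneg (hnonneg _ _ hT.le) (hN0 _), fun s hs => ?_⟩
    rw [Finset.sum_mul]
    refine Finset.sum_le_sum fun k _ => ?_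
    rw [mul_assoc]
    exact mul_le_mul_of_nonneg_left (hN _ (by omega) s hs) (hnonneg _ _ hT.le)
  obtain ⟨C, hC⟩ := hbdd j T hT.le
  set A := |C| * Real.exp (|γ| * T) with hA
  set K' := K * Real.exp (-(γ * T)) with hK'
  have hA0 : 0 ≤ A := by positivity
  have hK'0 : 0 ≤ K' := by positivity
  have key : ∀ n : ℕ, ∀ t : ℝ, 0 ≤ t → t ≤ (n + 1) * T →
      f j t ≤ (A + 2 * K') * Real.exp (γ * t) := by
    have base : ∀ t : ℝ, 0 ≤ t → t ≤ T → f j t ≤ (A + 2 * K') * Real.exp (γ * t) := by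
      intro t ht htT
      have h1 : 1 ≤ Real.exp (|γ| * T) * Real.exp (γ * t) := by
        rw [← Real.exp_add]
        apply Real.one_le_exp
        have h2 := mul_le_mul_of_nonneg_left htT (abs_nonneg γ)
        have h3 := mul_le_mul_of_nonneg_right (neg_abs_le γ) ht
        linarith
      have h4 := hC t ⟨ht, htT⟩
      have h5 := mul_le_mul_of_nonneg_left h1 (abs_nonneg C)
      have h6 : 0 ≤ K' * Real.exp (γ * t) := by positivity
      have h7 := le_abs_self C
      rw [hA]; nlinarith
    intro n
    induction n with
    | zero => intro t ht htT; exact base t ht (by simpa using htT)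
    | succ n ihn =>
      intro t ht htT
      rcases le_or_gt t T with h | h
      · exact base t ht h
      obtain ⟨s, rfl⟩ : ∃ s, t = T + s := ⟨t - T, by ring⟩
      have hs : 0 < s := by linarith
      have h1 := hsub j T s hT hs
      rw [Finset.sum_range_succ'] at h1
      have h2 := hK s hs.le
      have h3 := ihn s hs.le (by push_cast at htT; linarith)
      have h4 : f 0 T * f j s ≤
          (1 / 2 * Real.exp (γ * T)) * ((A + 2 * K') * Real.exp (γ * s)) :=
        mul_le_mul hsmall h3 (hnonneg _ _ hs.le) (by positivity)
      have h5 : Real.exp (γ * (T + s)) = Real.exp (γ * T) * Real.exp (γ * s) := by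
        rw [← Real.exp_add]; congr 1; ring
      have h6 : K * Real.exp (γ * s) = K' * (Real.exp (γ * T) * Real.exp (γ * s)) := by
        have : Real.exp (-(γ * T)) * Real.exp (γ * T) = 1 := by
          rw [← Real.exp_add]; simp
        rw [hK']
        linear_combination (-(K * Real.exp (γ * s))) * this
      have h7 : 0 ≤ A * (Real.exp (γ * T) * Real.exp (γ * s)) := by positivity
      simp only [Nat.sub_zero] at h1
      rw [h5]
      nlinarith
  refine ⟨A + 2 * K', by positivity, fun t ht => ?_⟩
  obtain ⟨n, hn⟩ := exists_nat_ge (t / T)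
  refine key n t ht ?_
  rw [div_le_iff₀ hT] at hn
  linarith
end

section
/- (a) If there exist an integer k ≥ 0 and a sequence of positive reals tₙ → ∞ such that Rₖ(tₙ) is a compact operator for every n, then ω_ess(R₀) ≤ ω_ess(T₀). (b) If there exist an integer k ≥ 0 and a sequence of positive reals tₙ → ∞ such that t ↦ Rₖ(t) is continuous at each tₙ in the operator norm, then ℓ^∞_{R₀}(X₀) = ℓ^∞_{T₀}(X₀), for each t the operator (xₙ) ↦ (R₀(t)xₙ) leaves ℓ^∞_{T₀}(X₀) invariant (so the induced quotient operators R̂₀(t) and T̂₀(t) are defined), and ω_crit(R₀) ≤ ω_crit(T₀). -/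
open Set Filter MeasureTheory
open scoped Topology

noncomputable section

variable {X : Type*} [NormedAddCommGroup X] [NormedSpace ℂ X] [CompleteSpace X]
  {X₀ : Submodule ℂ X}

/-- The essential growth bound of an operator family `W`, defined through the operator-norm
distance from `W t` to the compact operators. -/
def omegaEss (W : ℝ → (X₀ →L[ℂ] X₀)) : EReal :=
  sInf ((fun w : ℝ => (w : EReal)) ''
    {w : ℝ | ∃ C : ℝ, 0 ≤ C ∧ ∀ t : ℝ, 0 ≤ t →
      Metric.infDist (W t) {K : X₀ →L[ℂ] X₀ | IsCompactOperator ⇑K} ≤ C * Real.exp (w * t)})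

/-- The operator induced on `ℓ^∞(X₀)` (bounded sequences in `X₀`) by coordinatewise
application of a bounded operator. -/
def seqOp (W : X₀ →L[ℂ] X₀) :
    BoundedContinuousFunction ℕ X₀ →L[ℂ] BoundedContinuousFunction ℕ X₀ :=
  W.compLeftContinuousBounded ℕ

/-- The subspace `ℓ^∞_W(X₀)` of strong continuity of the extension of `W` to `ℓ^∞(X₀)`:
those bounded sequences `x` with `sup_n ‖W(t) xₙ − xₙ‖ → 0` as `t → 0⁺`. -/
def critSub (W : ℝ → (X₀ →L[ℂ] X₀)) : Submodule ℂ (BoundedContinuousFunction ℕ X₀) where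
  carrier := {x | Tendsto (fun t : ℝ => seqOp (W t) x) (𝓝[>] 0) (𝓝 x)}
  add_mem' := by
    intro a b ha hb
    simp only [Set.mem_setOf_eq, map_add] at ha hb ⊢
    exact Tendsto.add ha hb
  zero_mem' := by
    simp only [Set.mem_setOf_eq, map_zero]
    exact tendsto_const_nhds
  smul_mem' := by
    intro c x hx
    simp only [Set.mem_setOf_eq, _root_.map_smul] at hx ⊢
    exact Tendsto.const_smul hx c

/-- The critical growth bound of an operator family `W`: the growth bound of the operators
induced by `W` on the quotient `ℓ^∞(X₀)/ℓ^∞_W(X₀)`, expressed via the quotient norm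
`‖[x]‖ = infDist x ℓ^∞_W(X₀)`. -/
def omegaCrit (W : ℝ → (X₀ →L[ℂ] X₀)) : EReal :=
  sInf ((fun w : ℝ => (w : EReal)) ''
    {w : ℝ | ∃ C : ℝ, 0 ≤ C ∧ ∀ t : ℝ, 0 ≤ t → ∀ x : BoundedContinuousFunction ℕ X₀,
      Metric.infDist (seqOp (W t) x) (critSub W : Set (BoundedContinuousFunction ℕ X₀)) ≤
        C * Real.exp (w * t) *
          Metric.infDist x (critSub W : Set (BoundedContinuousFunction ℕ X₀))})


section gen
variable {E F : Type*} [NormedAddCommGroup E] [NormedSpace ℂ E]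
  [NormedAddCommGroup F] [NormedSpace ℂ F]

theorem gen_nonneg (A : E →L[ℂ] F) : 0 ≤ ‖A‖ := norm_nonneg A

theorem gen_tendsto_zero {ι : Type*} {l : Filter ι} {A : ι → (E →L[ℂ] F)} {g : ι → ℝ}
    (h1 : ∀ᶠ i in l, ‖A i‖ ≤ g i) (h2 : Tendsto g l (𝓝 0)) : Tendsto A l (𝓝 0) :=
  squeeze_zero_norm' h1 h2

theorem gen_norm_tendsto {ι : Type*} {l : Filter ι} {A : ι → (E →L[ℂ] F)} {A0 : E →L[ℂ] F}
    (h : Tendsto A l (𝓝 A0)) : Tendsto (fun i => ‖A i - A0‖) l (𝓝 0) :=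
  tendsto_iff_norm_sub_tendsto_zero.1 h

theorem gen_comp_left {ι : Type*} {l : Filter ι} {A : ι → (E →L[ℂ] E)} (B : E →L[ℂ] E)
    (h : Tendsto A l (𝓝 0)) : Tendsto (fun i => (A i).comp B) l (𝓝 0) := by
  have : Tendsto (fun i => A i * B) l (𝓝 (0 * B)) := h.mul_const _
  rwa [zero_mul] at this

theorem gen_comp_right {ι : Type*} {l : Filter ι} {A : ι → (E →L[ℂ] E)} (B : E →L[ℂ] E)
    (h : Tendsto A l (𝓝 0)) : Tendsto (fun i => B.comp (A i)) l (𝓝 0) := by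
  have : Tendsto (fun i => B * A i) l (𝓝 (B * 0)) := h.const_mul _
  rwa [mul_zero] at this

theorem gen_sum {ι κ : Type*} {l : Filter ι} (J : Finset κ) {A : κ → ι → (E →L[ℂ] E)}
    (h : ∀ j ∈ J, Tendsto (A j) l (𝓝 0)) : Tendsto (fun i => ∑ j ∈ J, A j i) l (𝓝 0) := by
  have := tendsto_finsetSum J h
  simpa using this

theorem gen_ess_comp (A B : E →L[ℂ] E) :
    Metric.infDist (A.comp B) {K : E →L[ℂ] E | IsCompactOperator ⇑K} ≤
      Metric.infDist A {K : E →L[ℂ] E | IsCompactOperator ⇑K} *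
        Metric.infDist B {K : E →L[ℂ] E | IsCompactOperator ⇑K} := by
  have hne : {K : E →L[ℂ] E | IsCompactOperator ⇑K}.Nonempty :=
    ⟨0, (compactOperator (RingHom.id ℂ) E E).zero_mem⟩
  refine le_mul_of_forall_lt₀ fun a ha b hb => ?_
  obtain ⟨y, hy, h1⟩ := (Metric.infDist_lt_iff hne).1 ha
  obtain ⟨z, hz, h2⟩ := (Metric.infDist_lt_iff hne).1 hb
  have hy' : IsCompactOperator y := hy
  have hz' : IsCompactOperator z := hz
  have hmem : y.comp B + (A - y).comp z ∈ compactOperator (RingHom.id ℂ) E E := by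
    refine Submodule.add_mem _ ?_ ?_
    · exact hy'.comp_clm B
    · exact hz'.clm_comp (A - y)
  refine (Metric.infDist_le_dist_of_mem
    (s := {K : E →L[ℂ] E | IsCompactOperator ⇑K}) hmem).trans ?_
  rw [dist_eq_norm] at h1 h2 ⊢
  have e : A.comp B - (y.comp B + (A - y).comp z) = (A - y).comp (B - z) := by
    ext x
    simp only [_root_.sub_apply, _root_.add_apply, ContinuousLinearMap.comp_apply, map_sub]
    abel
  rw [e]
  refine ((A - y).opNorm_comp_le (B - z)).trans ?_
  exact mul_le_mul h1.le h2.le (norm_nonneg _) ((norm_nonneg _).trans h1.le)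

theorem gen_ess_le (A : E →L[ℂ] E) :
    Metric.infDist A {K : E →L[ℂ] E | IsCompactOperator ⇑K} ≤ ‖A‖ := by
  have := Metric.infDist_le_dist_of_mem (x := A) (s := {K : E →L[ℂ] E | IsCompactOperator ⇑K})
    (compactOperator (RingHom.id ℂ) E E).zero_mem
  simpa using this

end gen

theorem aux_bdd {E F : Type*} [NormedAddCommGroup E] [NormedSpace ℂ E] [CompleteSpace E]
    [NormedAddCommGroup F] [NormedSpace ℂ F] (U : ℝ → (E →L[ℂ] F))
    (hU : ∀ x, ContinuousOn (fun t => U t x) (Ici 0)) (τ : ℝ) :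
    ∃ C : ℝ, 0 ≤ C ∧ ∀ t ∈ Icc (0:ℝ) τ, ‖U t‖ ≤ C := by
  obtain ⟨C, hC⟩ := banach_steinhaus (g := fun t : Icc (0:ℝ) τ => U t) (by
    intro x
    obtain ⟨C, hC⟩ := isCompact_Icc.exists_bound_of_continuousOn
      ((hU x).mono (fun t (ht : t ∈ Icc (0:ℝ) τ) => ht.1))
    exact ⟨C, fun t => hC t t.2⟩)
  exact ⟨max C 0, le_max_right _ _, fun t ht => (hC ⟨t, ht⟩).trans (le_max_left _ _)⟩

theorem aux_cont {E F : Type*} [NormedAddCommGroup E] [NormedSpace ℂ E] [CompleteSpace E]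
    [NormedAddCommGroup F] [NormedSpace ℂ F] (U : ℝ → (E →L[ℂ] F))
    (hU : ∀ x, ContinuousOn (fun t => U t x) (Ici 0)) (τ : ℝ) (K : Set ℝ) (g : ℝ → ℝ) (f : ℝ → E)
    (hg : ContinuousOn g K) (hgK : MapsTo g K (Icc 0 τ)) (hf : ContinuousOn f K) :
    ContinuousOn (fun s => U (g s) (f s)) K := by
  obtain ⟨C, hC0, hC⟩ := aux_bdd U hU τ
  intro s0 hs0
  have h1 : Tendsto (fun s => U (g s) (f s0)) (𝓝[K] s0) (𝓝 (U (g s0) (f s0))) :=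
    ((hU (f s0)).comp hg (fun s hs => (hgK hs).1)) s0 hs0
  have h2 : Tendsto (fun s => U (g s) (f s - f s0)) (𝓝[K] s0) (𝓝 0) := by
    refine squeeze_zero_norm' (a := fun s => C * ‖f s - f s0‖) ?_ ?_
    · filter_upwards [self_mem_nhdsWithin] with s hs
      exact (U (g s)).le_of_opNorm_le (hC _ (hgK hs)) _
    · have : Tendsto (fun s => f s - f s0) (𝓝[K] s0) (𝓝 (f s0 - f s0)) :=
        Tendsto.sub (hf s0 hs0) tendsto_const_nhds
      rw [sub_self] at this
      simpa using this.norm.const_mul C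
  have h3 := h2.add h1
  rw [zero_add] at h3
  refine h3.congr (fun s => ?_)
  simp

section aux
variable (M : MRSetting X X₀)

theorem aux_integrable (f : ℝ → X) (hf : ContinuousOn f (Ici 0)) (s τ : ℝ) (h0 : 0 ≤ s)
    (hs : s ≤ τ) :
    IntervalIntegrable (fun r => M.S (τ - r) (f r)) volume 0 s := by
  apply ContinuousOn.intervalIntegrable
  rw [uIcc_of_le h0]
  refine aux_cont M.S M.S_cont τ _ (fun r => τ - r) f (by fun_prop) ?_
    (hf.mono fun r hr => hr.1)
  intro r hr
  exact ⟨by simp only []; linarith [hr.2], by simp only []; linarith [hr.1]⟩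

theorem aux_shift (f : ℝ → X) (hf : ContinuousOn f (Ici 0)) (s : ℝ) (hs : 0 ≤ s) :
    ContinuousOn (fun r => f (s + r)) (Ici 0) :=
  hf.comp (by fun_prop) (fun r (hr : 0 ≤ r) => by simp only [mem_Ici]; linarith)

theorem aux_int_split (f : ℝ → X) (hf : ContinuousOn f (Ici 0)) (s t : ℝ) (hs : 0 ≤ s)
    (ht : 0 ≤ t) :
    ∫ r in (0:ℝ)..(t + s), M.S (t + s - r) (f r) =
      M.T t (∫ r in (0:ℝ)..s, M.S (s - r) (f r)) + M.S t (∫ r in (0:ℝ)..s, f r) +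
      ∫ r in (0:ℝ)..t, M.S (t - r) (f (s + r)) := by
  haveI : CompleteSpace X₀ := M.closed.completeSpace_coe
  have hi1 := aux_integrable M f hf s (t + s) hs (by linarith)
  have hi2 := aux_integrable M f hf (t + s) (t + s) (by linarith) le_rfl
  have hi3 := aux_integrable M f hf s s hs le_rfl
  have hfi : IntervalIntegrable f volume 0 s := by
    apply ContinuousOn.intervalIntegrable
    rw [uIcc_of_le hs]
    exact hf.mono fun r hr => hr.1
  rw [← intervalIntegral.integral_add_adjacent_intervals hi1 (hi1.symm.trans hi2)]
  congr 1
  · rw [← ContinuousLinearMap.intervalIntegral_comp_comm _ hi3,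
      ← ContinuousLinearMap.intervalIntegral_comp_comm _ hfi,
      ← intervalIntegral.integral_add]
    · apply intervalIntegral.integral_congr
      intro r hr
      rw [uIcc_of_le hs] at hr
      simp only []
      rw [M.TS t (s - r) ht (by linarith [hr.2])]
      rw [show t + (s - r) = t + s - r by ring]
      abel
    · exact ⟨(M.T t).integrable_comp hi3.1, (M.T t).integrable_comp hi3.2⟩
    · exact ⟨(M.S t).integrable_comp hfi.1, (M.S t).integrable_comp hfi.2⟩
  · have := intervalIntegral.integral_comp_add_left (a := 0) (b := t)
      (fun r => M.S (t + s - r) (f r)) s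
    rw [add_zero, add_comm s t] at this
    rw [← this]
    apply intervalIntegral.integral_congr
    intro r hr
    simp only []
    rw [show t + s - (s + r) = t - r by ring]

theorem aux_unique {E : Type*} [NormedAddCommGroup E] [NormedSpace ℝ E] {f : ℝ → E} {a b : E}
    {t : ℝ} (ht : 0 ≤ t)
    (h1 : HasDerivWithinAt f a (Ici 0) t) (h2 : HasDerivWithinAt f b (Ici 0) t) : a = b :=
  ((uniqueDiffOn_Ici (0:ℝ)) t ht).eq_deriv _ h1 h2

theorem aux_delta_zero : M.δ 0 = 0 := by
  refine le_antisymm ?_ (M.δ_nonneg 0 le_rfl)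
  refine ge_of_tendsto M.δ_lim ?_
  filter_upwards [self_mem_nhdsWithin] with t ht
  exact M.δ_mono (mem_Ici.2 le_rfl) (mem_Ici.2 (le_of_lt ht)) (le_of_lt ht)

theorem aux_SD_le (f : ℝ → X) (hf : ContinuousOn f (Ici 0)) (t : ℝ) (ht : 0 ≤ t) (C : ℝ)
    (hC : ∀ s ∈ Icc (0:ℝ) t, ‖f s‖ ≤ C) : ‖M.SD f t‖ ≤ M.δ t * C := by
  refine (M.SD_bound f hf t ht).trans ?_
  haveI : Nonempty (Icc (0:ℝ) t) := ⟨⟨0, le_rfl, ht⟩⟩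
  exact mul_le_mul_of_nonneg_left (ciSup_le fun s => hC s s.2) (M.δ_nonneg t ht)

theorem aux_SD_zero (f : ℝ → X) (hf : ContinuousOn f (Ici 0)) : M.SD f 0 = 0 := by
  have := aux_SD_le M f hf 0 le_rfl ‖f 0‖ (by
    intro s hs
    rw [le_antisymm hs.2 hs.1])
  rw [aux_delta_zero, zero_mul] at this
  exact norm_le_zero_iff.1 this

theorem aux_SD_congr (f g : ℝ → X) (hf : ContinuousOn f (Ici 0)) (h : ∀ s, 0 ≤ s → f s = g s)
    (t : ℝ) (ht : 0 ≤ t) : M.SD f t = M.SD g t := by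
  have hg : ContinuousOn g (Ici 0) := hf.congr fun s hs => (h s hs).symm
  refine aux_unique ht (M.SD_deriv f hf t ht) ((M.SD_deriv g hg t ht).congr ?_ ?_)
  · intro τ hτ
    apply intervalIntegral.integral_congr
    intro r hr
    rw [uIcc_of_le hτ] at hr
    simp only [h r hr.1]
  · apply intervalIntegral.integral_congr
    intro r hr
    rw [uIcc_of_le ht] at hr
    simp only [h r hr.1]

theorem aux_SD_add (f g : ℝ → X) (hf : ContinuousOn f (Ici 0)) (hg : ContinuousOn g (Ici 0))
    (t : ℝ) (ht : 0 ≤ t) : M.SD (fun s => f s + g s) t = M.SD f t + M.SD g t := by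
  have key : ∀ τ ∈ Ici (0:ℝ), ∫ r in (0:ℝ)..τ, M.S (τ - r) (f r + g r) =
      (∫ r in (0:ℝ)..τ, M.S (τ - r) (f r)) + ∫ r in (0:ℝ)..τ, M.S (τ - r) (g r) := by
    intro τ hτ
    rw [← intervalIntegral.integral_add (aux_integrable M f hf τ τ hτ le_rfl)
      (aux_integrable M g hg τ τ hτ le_rfl)]
    simp only [map_add]
  refine aux_unique ht (M.SD_deriv _ (hf.add hg) t ht) ?_
  exact ((M.SD_deriv f hf t ht).add (M.SD_deriv g hg t ht)).congr key (key t ht)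

theorem aux_SD_sub (f g : ℝ → X) (hf : ContinuousOn f (Ici 0)) (hg : ContinuousOn g (Ici 0))
    (t : ℝ) (ht : 0 ≤ t) : M.SD (fun s => f s - g s) t = M.SD f t - M.SD g t := by
  have := aux_SD_add M (fun s => f s - g s) g (hf.sub hg) hg t ht
  simp only [sub_add_cancel] at this
  rw [← sub_eq_iff_eq_add] at this
  exact this.symm

theorem aux_SD_sum {ι : Type*} (J : Finset ι) (f : ι → ℝ → X)
    (hf : ∀ i ∈ J, ContinuousOn (f i) (Ici 0))
    (t : ℝ) (ht : 0 ≤ t) : M.SD (fun s => ∑ i ∈ J, f i s) t = ∑ i ∈ J, M.SD (f i) t := by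
  classical
  induction J using Finset.induction_on with
  | empty =>
    simp only [Finset.sum_empty]
    have := aux_SD_le M (fun _ => (0:X)) continuousOn_const t ht 0 (by simp)
    rw [mul_zero] at this
    exact norm_le_zero_iff.1 this
  | insert a J ha ih =>
    simp only [Finset.sum_insert ha]
    rw [aux_SD_add M (f a) (fun s => ∑ i ∈ J, f i s) (hf a (Finset.mem_insert_self _ _))
      (continuousOn_finset_sum _ fun i hi => hf i (Finset.mem_insert_of_mem hi)) t ht,
      ih fun i hi => hf i (Finset.mem_insert_of_mem hi)]

/-- The cocycle identity for `S ⋄ f`. -/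
theorem aux_SD_cocycle (f : ℝ → X) (hf : ContinuousOn f (Ici 0)) (s t : ℝ) (hs : 0 ≤ s)
    (ht : 0 ≤ t) :
    M.SD f (t + s) = M.T t (M.SD f s) + M.SD (fun r => f (s + r)) t := by
  set F : X₀ := ∫ r in (0:ℝ)..s, M.S (s - r) (f r) with hF
  set G : X := ∫ r in (0:ℝ)..s, f r with hG
  set u : ℝ → X₀ := fun τ => M.T τ F + M.S τ G with hu
  have hfs := aux_shift f hf s hs
  have hder : ∀ τ : ℝ, 0 ≤ τ → HasDerivWithinAt u
      (M.SD f (τ + s) - M.SD (fun r => f (s + r)) τ) (Ici 0) τ := by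
    intro τ hτ
    have h1 := M.SD_deriv f hf (τ + s) (mem_Ici.2 (by linarith))
    have h2 := HasDerivWithinAt.scomp (h := fun y : ℝ => y + s) τ h1
      ((hasDerivWithinAt_id τ (Ici 0)).add_const s)
      (fun y (hy : 0 ≤ y) => by simp only [mem_Ici]; linarith)
    rw [one_smul] at h2
    have h3 := h2.sub (M.SD_deriv _ hfs τ hτ)
    refine h3.congr ?_ ?_
    · intro y hy
      have := aux_int_split M f hf s y hs hy
      simp only [Function.comp, Pi.sub_apply, this, hu]
      abel
    · have := aux_int_split M f hf s τ hs hτ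
      simp only [Function.comp, Pi.sub_apply, this, hu]
      abel
  have hrel : ∀ h : ℝ, 0 ≤ h → u (t + h) = u t + M.T t (u h - u 0) := by
    intro h hh
    simp only [hu, map_add, map_sub, M.T_add t h ht hh, M.T_zero, M.S_zero, M.TS t h ht hh,
      ContinuousLinearMap.comp_apply]
    simp only [ContinuousLinearMap.one_apply, ContinuousLinearMap.zero_apply, map_zero]
    abel
  have hA : HasDerivWithinAt (fun h => u (t + h))
      (M.SD f (t + s) - M.SD (fun r => f (s + r)) t) (Ici 0) 0 := by
    have h1 : HasDerivWithinAt u (M.SD f (t + s) - M.SD (fun r => f (s + r)) t) (Ici 0) (t + 0) := by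
      rw [add_zero]; exact hder t ht
    have h2 := HasDerivWithinAt.scomp (h := fun y : ℝ => t + y) 0 h1
      ((hasDerivWithinAt_id 0 (Ici 0)).const_add t)
      (fun y (hy : 0 ≤ y) => by simp only [mem_Ici]; linarith)
    rw [one_smul] at h2
    exact h2
  have hB : HasDerivWithinAt (fun h => u (t + h)) (M.T t (M.SD f s)) (Ici 0) 0 := by
    have h1 := hder 0 le_rfl
    rw [aux_SD_zero M _ hfs, zero_add, sub_zero] at h1
    have h2 := (((M.T t).restrictScalars ℝ).hasFDerivAt (x := u 0 - u 0)).comp_hasDerivWithinAt 0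
      (h1.sub_const (u 0))
    have h3 := h2.const_add (u t)
    refine h3.congr ?_ ?_
    · intro h hh
      exact hrel h hh
    · exact hrel 0 le_rfl
  have := aux_unique le_rfl hA hB
  rw [← this]
  abel

end aux

section aux2
variable (M : MRSetting X X₀) (L : X₀ →L[ℂ] X)

theorem aux_L_cont {U : ℝ → (X₀ →L[ℂ] X₀)} (hU : ∀ x : X₀, ContinuousOn (fun t => U t x) (Ici 0))
    (x : X₀) : ContinuousOn (fun s => L (U s x)) (Ici 0) :=
  L.continuous.comp_continuousOn (hU x)

theorem aux_B_apply {U : ℝ → (X₀ →L[ℂ] X₀)} (hU : ∀ x : X₀, ContinuousOn (fun t => U t x) (Ici 0))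
    (t : ℝ) (x : X₀) : M.Bop L U t x = M.SD (fun s => L (U s x)) t :=
  M.SDop_apply (fun s => L.comp (U s)) (fun x => aux_L_cont L hU x) t x

theorem aux_B_sc {U : ℝ → (X₀ →L[ℂ] X₀)} (hU : ∀ x : X₀, ContinuousOn (fun t => U t x) (Ici 0))
    (x : X₀) : ContinuousOn (fun t => M.Bop L U t x) (Ici 0) := by
  simp only [aux_B_apply M L hU]
  exact M.SD_cont _ (aux_L_cont L hU x)

theorem aux_iter_sc {U : ℝ → (X₀ →L[ℂ] X₀)}
    (hU : ∀ x : X₀, ContinuousOn (fun t => U t x) (Ici 0)) (n : ℕ) :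
    ∀ x : X₀, ContinuousOn (fun t => (M.Bop L)^[n] U t x) (Ici 0) := by
  induction n with
  | zero => exact hU
  | succ n ih =>
    rw [Function.iterate_succ_apply']
    exact aux_B_sc M L ih

theorem aux_B_norm {U : ℝ → (X₀ →L[ℂ] X₀)} (hU : ∀ x : X₀, ContinuousOn (fun t => U t x) (Ici 0))
    (t : ℝ) (ht : 0 ≤ t) (C : ℝ) (hC0 : 0 ≤ C) (hC : ∀ s ∈ Icc (0:ℝ) t, ‖U s‖ ≤ C) :
    ‖M.Bop L U t‖ ≤ M.δ t * (‖L‖ * C) := by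
  have hδ := M.δ_nonneg t ht
  refine ContinuousLinearMap.opNorm_le_bound _ (by positivity) fun x => ?_
  rw [aux_B_apply M L hU, mul_assoc]
  refine aux_SD_le M _ (aux_L_cont L hU x) t ht _ fun s hs => ?_
  rw [mul_assoc]
  refine (L.le_opNorm _).trans ?_
  gcongr
  exact (U s).le_of_opNorm_le (hC s hs) x

theorem aux_B_small {U : ℝ → (X₀ →L[ℂ] X₀)}
    (hU : ∀ x : X₀, ContinuousOn (fun t => U t x) (Ici 0)) :
    Tendsto (fun t => M.Bop L U t) (𝓝[>] 0) (𝓝 0) := by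
  have : CompleteSpace X₀ := M.closed.completeSpace_coe
  obtain ⟨C, hC0, hC⟩ := aux_bdd U hU 1
  refine gen_tendsto_zero (g := fun t => M.δ t * (‖L‖ * C)) ?_ ?_
  · filter_upwards [Ioo_mem_nhdsGT (zero_lt_one' ℝ)] with t ht
    exact aux_B_norm M L hU t ht.1.le C hC0 fun s hs => hC s ⟨hs.1, hs.2.trans ht.2.le⟩
  · have := M.δ_lim.mul_const (‖L‖ * C)
    rwa [zero_mul] at this

/-- Composition identity for the Dyson-Phillips terms. -/
theorem aux_S_comp (n : ℕ) : ∀ t s : ℝ, 0 ≤ t → 0 ≤ s →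
    (M.Bop L)^[n] M.T (t + s) = ∑ p ∈ Finset.HasAntidiagonal.antidiagonal n,
      ((M.Bop L)^[p.1] M.T t).comp ((M.Bop L)^[p.2] M.T s) := by
  induction n with
  | zero =>
    intro t s ht hs
    simpa using M.T_add t s ht hs
  | succ n ih =>
    intro t s ht hs
    have hsc := fun j => aux_iter_sc M L (U := M.T) M.T_cont j
    ext1 x
    rw [Finset.Nat.antidiagonal_succ, Finset.sum_cons, Finset.sum_map]
    simp only [Function.iterate_succ_apply', Function.Embedding.prodMap, Function.Embedding.coeFn_mk,
      Prod.map, Function.Embedding.refl_apply, Nat.succ_eq_add_one, Function.iterate_zero, id]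
    rw [aux_B_apply M L (hsc n), aux_SD_cocycle M _ (aux_L_cont L (hsc n) x) s t hs ht,
      ← aux_B_apply M L (hsc n)]
    simp only [_root_.add_apply, ContinuousLinearMap.comp_apply,
      _root_.sum_apply]
    congr 1
    have hc : ∀ p ∈ Finset.HasAntidiagonal.antidiagonal n, ContinuousOn
        (fun r => L ((M.Bop L)^[p.1] M.T r ((M.Bop L)^[p.2] M.T s x))) (Ici 0) :=
      fun p _ => aux_L_cont L (hsc p.1) _
    rw [aux_SD_congr M _ (fun r => ∑ p ∈ Finset.HasAntidiagonal.antidiagonal n,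
      L ((M.Bop L)^[p.1] M.T r ((M.Bop L)^[p.2] M.T s x)))
      (aux_shift _ (aux_L_cont L (hsc n) x) s hs) ?_ t ht, aux_SD_sum M _ _ hc t ht]
    · refine Finset.sum_congr rfl fun p _ => ?_
      rw [aux_B_apply M L (hsc p.1)]
    · intro r hr
      rw [add_comm s r, ih r s hr hs]
      simp only [_root_.sum_apply, ContinuousLinearMap.comp_apply, map_sum]

/-- Uniqueness for the homogeneous equation. -/
theorem aux_hom_unique : ∃ h : ℝ, 0 < h ∧ ∀ D : ℝ → X₀, ContinuousOn D (Ici 0) →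
    (∀ t, 0 ≤ t → D t = M.SD (fun s => L (D s)) t) → ∀ t ∈ Icc (0:ℝ) h, D t = 0 := by
  have h1 : Tendsto (fun t => M.δ t * ‖L‖) (𝓝[>] 0) (𝓝 0) := by
    simpa using M.δ_lim.mul_const ‖L‖
  obtain ⟨h, hh, hpos⟩ := ((h1.eventually_lt_const one_pos).and self_mem_nhdsWithin).exists
  have hpos : 0 < h := hpos
  refine ⟨h, hpos, fun D hD hfix => ?_⟩
  obtain ⟨t0, ht0, hmax⟩ := isCompact_Icc.exists_isMaxOn (nonempty_Icc.2 hpos.le)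
    ((hD.mono fun t (ht : t ∈ Icc 0 h) => ht.1).norm)
  have hle : ‖D t0‖ ≤ M.δ t0 * (‖L‖ * ‖D t0‖) := by
    conv_lhs => rw [hfix t0 ht0.1]
    refine aux_SD_le M _ (L.continuous.comp_continuousOn hD) t0 ht0.1 _ fun s hs => ?_
    refine (L.le_opNorm _).trans ?_
    gcongr
    exact hmax ⟨hs.1, hs.2.trans ht0.2⟩
  have hδ : M.δ t0 ≤ M.δ h := M.δ_mono ht0.1 hpos.le ht0.2
  have hz : ‖D t0‖ ≤ 0 := by
    by_contra hc
    push Not at hc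
    have : M.δ t0 * ‖L‖ ≤ M.δ h * ‖L‖ := by gcongr
    nlinarith
  intro t ht
  exact norm_le_zero_iff.1 ((hmax ht).trans hz)

theorem aux_hom_zero (D : ℝ → X₀) (hD : ContinuousOn D (Ici 0))
    (hfix : ∀ t, 0 ≤ t → D t = M.SD (fun s => L (D s)) t) (t : ℝ) (ht : 0 ≤ t) : D t = 0 := by
  obtain ⟨h, hh, huniq⟩ := aux_hom_unique M L
  have key : ∀ n : ℕ, ∀ D : ℝ → X₀, ContinuousOn D (Ici 0) →
      (∀ t, 0 ≤ t → D t = M.SD (fun s => L (D s)) t) → ∀ t ∈ Icc (0:ℝ) (n * h), D t = 0 := by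
    intro n
    induction n with
    | zero =>
      intro D hD hfix t ht
      refine huniq D hD hfix t ⟨ht.1, ht.2.trans ?_⟩
      simpa using hh.le
    | succ n ih =>
      intro D hD hfix t ht
      by_cases hth : t ≤ h
      · exact huniq D hD hfix t ⟨ht.1, hth⟩
      push Not at hth
      have hDh : ContinuousOn (fun r => D (h + r)) (Ici 0) :=
        hD.comp (by fun_prop) (fun r (hr : 0 ≤ r) => by simp only [mem_Ici]; linarith)
      have := ih (fun r => D (h + r)) hDh (by
        intro r hr
        have hLD : ContinuousOn (fun s => L (D s)) (Ici 0) := L.continuous.comp_continuousOn hD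
        have h0 := huniq D hD hfix h ⟨hh.le, le_rfl⟩
        rw [add_comm h r, hfix _ (by linarith), aux_SD_cocycle M _ hLD h r hh.le hr,
          ← hfix h hh.le, h0, map_zero, zero_add]) (t - h) ⟨by linarith, by
            have := ht.2; push_cast at this; linarith⟩
      simpa using this
  obtain ⟨n, hn⟩ := exists_nat_ge (t / h)
  exact key n D hD hfix t ⟨ht, (div_le_iff₀ hh).1 hn⟩

theorem aux_R_add (R : ℝ → (X₀ →L[ℂ] X₀))
    (hRsc : ∀ x : X₀, ContinuousOn (fun t => R t x) (Ici 0))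
    (hRfix : ∀ t ∈ Ici (0:ℝ), R t = M.T t + M.Bop L R t)
    (t s : ℝ) (ht : 0 ≤ t) (hs : 0 ≤ s) : R (t + s) = (R t).comp (R s) := by
  ext1 x
  have hRx : ContinuousOn (fun r => R (r + s) x) (Ici 0) :=
    (hRsc x).comp (by fun_prop) (fun r (hr : 0 ≤ r) => by simp only [mem_Ici]; linarith)
  have hD := hRx.sub (hRsc (R s x))
  have := aux_hom_zero M L (fun r => R (r + s) x - R r (R s x)) hD (by
    intro r hr
    simp only [map_sub]
    rw [aux_SD_sub M (fun q => L (R (q + s) x)) _ (L.continuous.comp_continuousOn hRx) (aux_L_cont L hRsc (R s x)) r hr,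
      ← aux_B_apply M L hRsc]
    have e1 : R (r + s) x = M.T r (R s x) + M.SD (fun q => L (R (q + s) x)) r := by
      rw [hRfix (r + s) (mem_Ici.2 (by linarith)), M.T_add r s hr hs]
      simp only [_root_.add_apply, ContinuousLinearMap.comp_apply]
      rw [aux_B_apply M L hRsc, aux_SD_cocycle M _ (aux_L_cont L hRsc x) s r hs hr,
        ← aux_B_apply M L hRsc, ← add_assoc, ← map_add, hRfix s hs]
      simp only [_root_.add_apply, add_comm s]
    have e2 : R r (R s x) = M.T r (R s x) + M.Bop L R r (R s x) := by
      conv_lhs => rw [hRfix r hr]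
      rfl
    rw [e1, e2]
    abel) t ht
  exact sub_eq_zero.1 this

theorem aux_R_iter (R : ℝ → (X₀ →L[ℂ] X₀))
    (hRsc : ∀ x : X₀, ContinuousOn (fun t => R t x) (Ici 0))
    (hRfix : ∀ t ∈ Ici (0:ℝ), R t = M.T t + M.Bop L R t)
    (k : ℕ) : ∀ t : ℝ, 0 ≤ t →
    (M.Bop L)^[k] R t = R t - ∑ j ∈ Finset.range k, (M.Bop L)^[j] M.T t := by
  induction k with
  | zero => intro t ht; simp
  | succ k ih =>
    intro t ht
    have hsc := fun j => aux_iter_sc M L (U := M.T) M.T_cont j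
    ext1 x
    rw [Function.iterate_succ_apply', aux_B_apply M L (aux_iter_sc M L hRsc k)]
    have hc : ∀ j ∈ Finset.range k, ContinuousOn (fun s => L ((M.Bop L)^[j] M.T s x)) (Ici 0) :=
      fun j _ => aux_L_cont L (hsc j) x
    rw [aux_SD_congr M _ (fun s => L (R s x) - ∑ j ∈ Finset.range k, L ((M.Bop L)^[j] M.T s x))
      (aux_L_cont L (aux_iter_sc M L hRsc k) x) ?_ t ht,
      aux_SD_sub M _ _ (aux_L_cont L hRsc x) (continuousOn_finsetSum _ hc) t ht,
      aux_SD_sum M _ _ hc t ht, ← aux_B_apply M L hRsc, hRfix t ht, Finset.sum_range_succ']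
    · simp only [Function.iterate_succ_apply', Function.iterate_zero, id,
        _root_.add_apply, _root_.sub_apply,
        _root_.sum_apply, aux_B_apply M L (hsc _)]
      abel
    · intro s hs
      rw [ih s hs]
      simp only [_root_.sub_apply, _root_.sum_apply, map_sub, map_sum]

end aux2

theorem aux_rec (b : ℝ → ℝ) (τ q D K : ℝ) (hτ : 0 < τ) (hq : 0 ≤ q) (hq1 : q < 1) (hD : 0 ≤ D)
    (hK0 : 0 ≤ K) (hK : ∀ t ∈ Icc (0:ℝ) τ, b t ≤ K)
    (hb : ∀ t, 0 ≤ t → b (t + τ) ≤ q * b t + D) (t : ℝ) (ht : 0 ≤ t) :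
    b t ≤ K + D / (1 - q) := by
  have hd : 0 ≤ D / (1 - q) := div_nonneg hD (by linarith)
  have hd2 : q * (D / (1 - q)) + D = D / (1 - q) := by
    have : 1 - q ≠ 0 := by linarith
    field_simp
    ring
  have key : ∀ n : ℕ, ∀ t, 0 ≤ t → t ≤ n * τ → b t ≤ K + D / (1 - q) := by
    intro n
    induction n with
    | zero =>
      intro t ht htn
      have := hK t ⟨ht, htn.trans (by simpa using hτ.le)⟩
      linarith
    | succ n ih =>
      intro t ht htn
      by_cases hth : t ≤ τ
      · have := hK t ⟨ht, hth⟩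
        linarith
      push Not at hth
      have h1 := ih (t - τ) (by linarith) (by push_cast at htn; linarith)
      have h2 := hb (t - τ) (by linarith)
      rw [sub_add_cancel] at h2
      nlinarith
  obtain ⟨n, hn⟩ := exists_nat_ge (t / τ)
  exact key n t ht ((div_le_iff₀ hτ).1 hn)

theorem aux_exp_large (C w w' : ℝ) (hw : w' < w) :
    ∀ᶠ t : ℝ in atTop, C * Real.exp (w' * t) ≤ 1 / 2 * Real.exp (w * t) := by
  have h1 : Tendsto (fun t : ℝ => Real.exp ((w - w') * t)) atTop atTop :=
    Real.tendsto_exp_atTop.comp (tendsto_id.const_mul_atTop (by linarith))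
  filter_upwards [h1.eventually_ge_atTop (2 * C)] with t ht
  have : Real.exp (w * t) = Real.exp ((w - w') * t) * Real.exp (w' * t) := by
    rw [← Real.exp_add]; ring_nf
  rw [this]
  have := Real.exp_pos (w' * t)
  nlinarith

theorem aux_growth1 (a : ℕ → ℝ → ℝ) (h0 : ∀ n t, 0 ≤ a n t)
    (hb : ∀ n τ, ∃ K, ∀ t ∈ Icc (0:ℝ) τ, a n t ≤ K)
    (hadd : ∀ n t s, 0 ≤ t → 0 ≤ s →
      a n (t + s) ≤ ∑ p ∈ Finset.HasAntidiagonal.antidiagonal n, a p.1 t * a p.2 s)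
    (C w w' : ℝ) (hw : w' < w) (hC : ∀ t, 0 ≤ t → a 0 t ≤ C * Real.exp (w' * t)) (n : ℕ) :
    ∃ C', 0 ≤ C' ∧ ∀ t, 0 ≤ t → a n t ≤ C' * Real.exp (w * t) := by
  obtain ⟨τ, hτ, hτ0⟩ := ((aux_exp_large C w w' hw).and (eventually_gt_atTop 0)).exists
  have ha0 := (hC τ hτ0.le).trans hτ
  induction n using Nat.strong_induction_on with
  | _ n ih =>
  choose! c hc0 hc using ih
  obtain ⟨K, hK⟩ := hb n τ
  set b : ℝ → ℝ := fun t => Real.exp (-(w * t)) * a n t with hbdef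
  set E0 : ℝ := Real.exp (-(w * τ)) with hE0
  set D : ℝ := E0 * ∑ i ∈ Finset.range n, a (i + 1) τ * c (n - (i + 1)) with hD
  have hD0 : 0 ≤ D := by
    refine mul_nonneg (Real.exp_pos _).le (Finset.sum_nonneg fun i hi => ?_)
    have := Finset.mem_range.1 hi
    exact mul_nonneg (h0 _ _) (hc0 _ (by omega))
  have hrec : ∀ t, 0 ≤ t → b (t + τ) ≤ 1 / 2 * b t + D := by
    intro t ht
    have h1 := hadd n τ t hτ0.le ht
    rw [Finset.Nat.sum_antidiagonal_eq_sum_range_succ (fun i j => a i τ * a j t),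
      Finset.sum_range_succ'] at h1
    have h2 : ∑ i ∈ Finset.range n, a (i + 1) τ * a (n - (i + 1)) t ≤
        (∑ i ∈ Finset.range n, a (i + 1) τ * c (n - (i + 1))) * Real.exp (w * t) := by
      rw [Finset.sum_mul]
      refine Finset.sum_le_sum fun i hi => ?_
      have := Finset.mem_range.1 hi
      rw [mul_assoc]
      exact mul_le_mul_of_nonneg_left (hc _ (by omega) t ht) (h0 _ _)
    have h3 : a 0 τ * a (n - 0) t ≤ 1 / 2 * Real.exp (w * τ) * a n t :=
      mul_le_mul_of_nonneg_right ha0 (h0 _ _)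
    have e1 : Real.exp (-(w * (t + τ))) = E0 * Real.exp (-(w * t)) := by
      rw [hE0, ← Real.exp_add]; ring_nf
    have e2 : E0 * Real.exp (w * τ) = 1 := by
      rw [hE0, ← Real.exp_add]; simp
    have e3 : Real.exp (-(w * t)) * Real.exp (w * t) = 1 := by
      rw [← Real.exp_add]; simp
    have hp : 0 ≤ E0 * Real.exp (-(w * t)) := by positivity
    calc b (t + τ) = E0 * Real.exp (-(w * t)) * a n (τ + t) := by
          simp only [hbdef]; rw [e1, add_comm t τ]
      _ ≤ E0 * Real.exp (-(w * t)) *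
          ((∑ i ∈ Finset.range n, a (i + 1) τ * c (n - (i + 1))) * Real.exp (w * t) +
            1 / 2 * Real.exp (w * τ) * a n t) :=
          mul_le_mul_of_nonneg_left (by linarith) hp
      _ = (E0 * Real.exp (w * τ)) * (1 / 2 * b t) +
          (Real.exp (-(w * t)) * Real.exp (w * t)) * D := by
          simp only [hbdef, hD]; ring
      _ = 1 / 2 * b t + D := by rw [e2, e3]; ring
  obtain ⟨Q, hQ⟩ := isCompact_Icc.exists_bound_of_continuousOn
    (f := fun t : ℝ => Real.exp (-(w * t))) (s := Icc 0 τ) (by fun_prop)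
  have hbK : ∀ t ∈ Icc (0:ℝ) τ, b t ≤ |Q| * |K| := by
    intro t ht
    have h1 := (le_abs_self _).trans (hQ t ht)
    exact mul_le_mul (h1.trans (le_abs_self Q)) ((hK t ht).trans (le_abs_self K)) (h0 _ _)
      (abs_nonneg _)
  refine ⟨|Q| * |K| + D / (1 - 1 / 2), by positivity, fun t ht => ?_⟩
  have := aux_rec b τ (1 / 2) D (|Q| * |K|) hτ0 (by norm_num) (by norm_num) hD0 (by positivity)
    hbK hrec t ht
  have e3 : Real.exp (-(w * t)) * Real.exp (w * t) = 1 := by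
    rw [← Real.exp_add]; simp
  calc a n t = b t * Real.exp (w * t) := by
        simp only [hbdef]
        rw [mul_right_comm, e3, one_mul]
    _ ≤ _ := mul_le_mul_of_nonneg_right this (Real.exp_pos _).le

/-- The scalar core: growth of `r` from growth of `a 0`. -/
theorem aux_core (a : ℕ → ℝ → ℝ) (r : ℝ → ℝ) (h0 : ∀ n t, 0 ≤ a n t) (hr0 : ∀ t, 0 ≤ r t)
    (hb : ∀ n τ, ∃ K, ∀ t ∈ Icc (0:ℝ) τ, a n t ≤ K)
    (hrb : ∀ τ, ∃ K, ∀ t ∈ Icc (0:ℝ) τ, r t ≤ K)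
    (hadd : ∀ n t s, 0 ≤ t → 0 ≤ s →
      a n (t + s) ≤ ∑ p ∈ Finset.HasAntidiagonal.antidiagonal n, a p.1 t * a p.2 s)
    (hradd : ∀ t s, 0 ≤ t → 0 ≤ s → r (t + s) ≤ r t * r s)
    (k : ℕ) (ts : ℕ → ℝ) (hts : ∀ n, 0 < ts n) (hlim : Tendsto ts atTop atTop)
    (hk : ∀ n, r (ts n) ≤ ∑ j ∈ Finset.range k, a j (ts n))
    (C w w' : ℝ) (hw : w' < w) (hC : ∀ t, 0 ≤ t → a 0 t ≤ C * Real.exp (w' * t)) :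
    ∃ C', 0 ≤ C' ∧ ∀ t, 0 ≤ t → r t ≤ C' * Real.exp (w * t) := by
  obtain ⟨v, hv1, hv2⟩ := exists_between hw
  choose c hc0 hc using aux_growth1 a h0 hb hadd C v w' hv1 hC
  obtain ⟨n, hn⟩ := (hlim.eventually
    (aux_exp_large (∑ j ∈ Finset.range k, c j) w v hv2)).exists
  have hτ : r (ts n) ≤ 1 / 2 * Real.exp (w * ts n) := by
    refine (hk n).trans (le_trans ?_ hn)
    rw [Finset.sum_mul]
    exact Finset.sum_le_sum fun j _ => hc j _ (hts n).le
  set τ := ts n with hτdef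
  obtain ⟨K, hK⟩ := hrb τ
  obtain ⟨Q, hQ⟩ := isCompact_Icc.exists_bound_of_continuousOn
    (f := fun t : ℝ => Real.exp (-(w * t))) (s := Icc 0 τ) (by fun_prop)
  have hbK : ∀ t ∈ Icc (0:ℝ) τ, Real.exp (-(w * t)) * r t ≤ |Q| * |K| := by
    intro t ht
    have h1 := (le_abs_self _).trans (hQ t ht)
    exact mul_le_mul (h1.trans (le_abs_self Q)) ((hK t ht).trans (le_abs_self K)) (hr0 _)
      (abs_nonneg _)
  have hrec : ∀ t, 0 ≤ t → Real.exp (-(w * (t + τ))) * r (t + τ) ≤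
      1 / 2 * (Real.exp (-(w * t)) * r t) + 0 := by
    intro t ht
    have h1 : r (t + τ) ≤ r t * (1 / 2 * Real.exp (w * τ)) :=
      (hradd t τ ht (hts n).le).trans (mul_le_mul_of_nonneg_left hτ (hr0 _))
    have e : Real.exp (-(w * (t + τ))) * Real.exp (w * τ) = Real.exp (-(w * t)) := by
      rw [← Real.exp_add]; ring_nf
    calc _ ≤ Real.exp (-(w * (t + τ))) * (r t * (1 / 2 * Real.exp (w * τ))) :=
          mul_le_mul_of_nonneg_left h1 (Real.exp_pos _).le
      _ = 1 / 2 * ((Real.exp (-(w * (t + τ))) * Real.exp (w * τ)) * r t) := by ring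
      _ = _ := by rw [e, add_zero]
  refine ⟨|Q| * |K|, by positivity, fun t ht => ?_⟩
  have := aux_rec (fun t => Real.exp (-(w * t)) * r t) τ (1 / 2) 0 (|Q| * |K|) (hts n)
    (by norm_num) (by norm_num) le_rfl (by positivity) hbK hrec t ht
  simp only [zero_div, add_zero] at this
  have e3 : Real.exp (-(w * t)) * Real.exp (w * t) = 1 := by
    rw [← Real.exp_add]; simp
  calc r t = Real.exp (-(w * t)) * r t * Real.exp (w * t) := by
        rw [mul_right_comm, e3, one_mul]
    _ ≤ _ := mul_le_mul_of_nonneg_right this (Real.exp_pos _).le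

theorem aux_sInf (A B : Set ℝ) (h : ∀ w' ∈ B, ∀ w, w' < w → w ∈ A) :
    sInf ((fun w : ℝ => (w : EReal)) '' A) ≤ sInf ((fun w : ℝ => (w : EReal)) '' B) := by
  refine le_sInf ?_
  rintro _ ⟨w', hw', rfl⟩
  refine EReal.le_of_forall_lt_iff_le.1 fun z hz => ?_
  exact sInf_le ⟨z, h w' hw' z (EReal.coe_lt_coe_iff.1 hz), rfl⟩

theorem aux_infDist_add {V : Type*} [NormedAddCommGroup V] [NormedSpace ℂ V] (Y : Submodule ℂ V)
    (a b : V) :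
    Metric.infDist (a + b) (Y : Set V) ≤ Metric.infDist a (Y : Set V) + Metric.infDist b Y := by
  have hne : (Y : Set V).Nonempty := ⟨0, Y.zero_mem⟩
  refine le_of_forall_pos_le_add fun ε hε => ?_
  obtain ⟨y, hy, h1⟩ := (Metric.infDist_lt_iff hne).1
    (show Metric.infDist a (Y : Set V) < Metric.infDist a (Y : Set V) + ε / 2 by linarith)
  obtain ⟨z, hz, h2⟩ := (Metric.infDist_lt_iff hne).1
    (show Metric.infDist b (Y : Set V) < Metric.infDist b (Y : Set V) + ε / 2 by linarith)
  have h3 := Metric.infDist_le_dist_of_mem (x := a + b) (Y.add_mem hy hz)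
  have h4 := dist_add_add_le a b y z
  linarith

theorem aux_infDist_sum {V : Type*} [NormedAddCommGroup V] [NormedSpace ℂ V] (Y : Submodule ℂ V)
    {ι : Type*} (J : Finset ι) (f : ι → V) :
    Metric.infDist (∑ i ∈ J, f i) (Y : Set V) ≤ ∑ i ∈ J, Metric.infDist (f i) (Y : Set V) := by
  classical
  induction J using Finset.induction_on with
  | empty =>
    simp only [Finset.sum_empty]
    exact (Metric.infDist_zero_of_mem (s := (Y : Set V)) Y.zero_mem).le
  | insert a J ha ih =>
    rw [Finset.sum_insert ha, Finset.sum_insert ha]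
    exact (aux_infDist_add Y _ _).trans (by linarith)

section aux4
theorem gen_ess_add {E : Type*} [NormedAddCommGroup E] [NormedSpace ℂ E] (A B : E →L[ℂ] E) :
    Metric.infDist (A + B) {K : E →L[ℂ] E | IsCompactOperator ⇑K} ≤
      Metric.infDist A {K : E →L[ℂ] E | IsCompactOperator ⇑K} +
        Metric.infDist B {K : E →L[ℂ] E | IsCompactOperator ⇑K} :=
  aux_infDist_add (compactOperator (RingHom.id ℂ) E E) A B

theorem gen_ess_sum {E : Type*} [NormedAddCommGroup E] [NormedSpace ℂ E] {ι : Type*}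
    (J : Finset ι) (A : ι → (E →L[ℂ] E)) :
    Metric.infDist (∑ i ∈ J, A i) {K : E →L[ℂ] E | IsCompactOperator ⇑K} ≤
      ∑ i ∈ J, Metric.infDist (A i) {K : E →L[ℂ] E | IsCompactOperator ⇑K} :=
  aux_infDist_sum (compactOperator (RingHom.id ℂ) E E) J A

/-- The essential norm. -/
def auxE (A : X₀ →L[ℂ] X₀) : ℝ :=
  Metric.infDist A {K : X₀ →L[ℂ] X₀ | IsCompactOperator ⇑K}

theorem auxE_nonneg (A : X₀ →L[ℂ] X₀) : 0 ≤ auxE A := Metric.infDist_nonneg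

theorem auxE_comp (A B : X₀ →L[ℂ] X₀) : auxE (A.comp B) ≤ auxE A * auxE B := gen_ess_comp A B

theorem auxE_le (A : X₀ →L[ℂ] X₀) : auxE A ≤ ‖A‖ := gen_ess_le A

theorem auxE_add (A B : X₀ →L[ℂ] X₀) : auxE (A + B) ≤ auxE A + auxE B := gen_ess_add A B

theorem auxE_sum {ι : Type*} (J : Finset ι) (A : ι → (X₀ →L[ℂ] X₀)) :
    auxE (∑ i ∈ J, A i) ≤ ∑ i ∈ J, auxE (A i) := gen_ess_sum J A

theorem auxE_zero (A : X₀ →L[ℂ] X₀) (hA : IsCompactOperator ⇑A) : auxE A = 0 :=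
  Metric.infDist_zero_of_mem hA

theorem aux_seq_apply (A : X₀ →L[ℂ] X₀) (x : BoundedContinuousFunction ℕ X₀) (n : ℕ) :
    seqOp A x n = A (x n) := rfl

theorem aux_seq_norm (A : X₀ →L[ℂ] X₀) (x : BoundedContinuousFunction ℕ X₀) :
    ‖seqOp A x‖ ≤ ‖A‖ * ‖x‖ := by
  refine (BoundedContinuousFunction.norm_le (by positivity)).2 fun n => ?_
  rw [aux_seq_apply]
  exact A.le_opNorm_of_le (x.norm_coe_le_norm n)

theorem aux_seq_add (A B : X₀ →L[ℂ] X₀) (x : BoundedContinuousFunction ℕ X₀) :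
    seqOp (A + B) x = seqOp A x + seqOp B x := by
  ext n; simp [aux_seq_apply]

theorem aux_seq_sub (A B : X₀ →L[ℂ] X₀) (x : BoundedContinuousFunction ℕ X₀) :
    seqOp (A - B) x = seqOp A x - seqOp B x := by
  ext n; simp [aux_seq_apply]

theorem aux_seq_comp (A B : X₀ →L[ℂ] X₀) (x : BoundedContinuousFunction ℕ X₀) :
    seqOp (A.comp B) x = seqOp A (seqOp B x) := by
  ext n; simp [aux_seq_apply]

theorem aux_seq_zero (x : BoundedContinuousFunction ℕ X₀) :
    seqOp (0 : X₀ →L[ℂ] X₀) x = 0 := by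
  ext n; simp [aux_seq_apply]

theorem aux_seq_sum {ι : Type*} (J : Finset ι) (A : ι → (X₀ →L[ℂ] X₀))
    (x : BoundedContinuousFunction ℕ X₀) :
    seqOp (∑ i ∈ J, A i) x = ∑ i ∈ J, seqOp (A i) x := by
  classical
  induction J using Finset.induction_on with
  | empty => simp [aux_seq_zero]
  | insert a J ha ih => rw [Finset.sum_insert ha, Finset.sum_insert ha, aux_seq_add, ih]

theorem aux_seq_tendsto {ι : Type*} {l : Filter ι} {A : ι → (X₀ →L[ℂ] X₀)} {A0 : X₀ →L[ℂ] X₀}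
    (h : Tendsto A l (𝓝 A0)) (x : BoundedContinuousFunction ℕ X₀) :
    Tendsto (fun i => seqOp (A i) x) l (𝓝 (seqOp A0 x)) := by
  replace h := gen_norm_tendsto h
  rw [tendsto_iff_norm_sub_tendsto_zero]
  refine squeeze_zero (fun i => norm_nonneg _) (g := fun i => ‖A i - A0‖ * ‖x‖) (fun i => ?_) ?_
  · rw [← aux_seq_sub]
    exact aux_seq_norm _ _
  · have := h.mul_const ‖x‖
    rwa [zero_mul] at this

/-- The quotient norm of the operator induced on `ℓ^∞/Y`. -/
def auxN (Y : Submodule ℂ (BoundedContinuousFunction ℕ X₀)) (A : X₀ →L[ℂ] X₀) : ℝ :=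
  sInf {c : ℝ | 0 ≤ c ∧ ∀ x : BoundedContinuousFunction ℕ X₀,
    Metric.infDist (seqOp A x) (Y : Set (BoundedContinuousFunction ℕ X₀)) ≤
      c * Metric.infDist x (Y : Set (BoundedContinuousFunction ℕ X₀))}

variable (Y : Submodule ℂ (BoundedContinuousFunction ℕ X₀))

theorem auxN_nonneg (A : X₀ →L[ℂ] X₀) : 0 ≤ auxN Y A := Real.sInf_nonneg fun _ h => h.1

theorem auxN_le_of (A : X₀ →L[ℂ] X₀) (c : ℝ) (hc : 0 ≤ c)
    (h : ∀ x : BoundedContinuousFunction ℕ X₀,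
    Metric.infDist (seqOp A x) (Y : Set (BoundedContinuousFunction ℕ X₀)) ≤
      c * Metric.infDist x (Y : Set (BoundedContinuousFunction ℕ X₀))) : auxN Y A ≤ c :=
  csInf_le ⟨0, fun _ h => h.1⟩ ⟨hc, h⟩

theorem aux_crit_bound (A : X₀ →L[ℂ] X₀) (hA : ∀ y ∈ Y, seqOp A y ∈ Y)
    (x : BoundedContinuousFunction ℕ X₀) :
    Metric.infDist (seqOp A x) (Y : Set (BoundedContinuousFunction ℕ X₀)) ≤
      ‖A‖ * Metric.infDist x (Y : Set (BoundedContinuousFunction ℕ X₀)) := by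
  have hne : (Y : Set (BoundedContinuousFunction ℕ X₀)).Nonempty := ⟨0, Y.zero_mem⟩
  refine le_mul_of_forall_lt₀ fun a ha b hb => ?_
  obtain ⟨y, hy, h1⟩ := (Metric.infDist_lt_iff hne).1 hb
  refine (Metric.infDist_le_dist_of_mem (hA y hy)).trans ?_
  rw [dist_eq_norm] at h1 ⊢
  rw [← map_sub]
  refine (aux_seq_norm _ _).trans ?_
  exact mul_le_mul ha.le h1.le (norm_nonneg _) ((gen_nonneg A).trans ha.le)

theorem auxN_le_norm (A : X₀ →L[ℂ] X₀) (hA : ∀ y ∈ Y, seqOp A y ∈ Y) : auxN Y A ≤ ‖A‖ :=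
  auxN_le_of Y A _ (gen_nonneg A) (aux_crit_bound Y A hA)

theorem auxN_spec (A : X₀ →L[ℂ] X₀) (hA : ∀ y ∈ Y, seqOp A y ∈ Y)
    (x : BoundedContinuousFunction ℕ X₀) :
    Metric.infDist (seqOp A x) (Y : Set (BoundedContinuousFunction ℕ X₀)) ≤
      auxN Y A * Metric.infDist x (Y : Set (BoundedContinuousFunction ℕ X₀)) := by
  rcases (Metric.infDist_nonneg (x := x)
    (s := (Y : Set (BoundedContinuousFunction ℕ X₀)))).eq_or_lt with h | h
  · have := aux_crit_bound Y A hA x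
    rw [← h, mul_zero] at this ⊢
    exact this
  · rw [← div_le_iff₀ h]
    refine le_csInf ⟨_, gen_nonneg A, aux_crit_bound Y A hA⟩ fun c hc => ?_
    rw [div_le_iff₀ h]
    exact hc.2 x

theorem auxN_comp (A B : X₀ →L[ℂ] X₀) (hA : ∀ y ∈ Y, seqOp A y ∈ Y)
    (hB : ∀ y ∈ Y, seqOp B y ∈ Y) : auxN Y (A.comp B) ≤ auxN Y A * auxN Y B := by
  refine auxN_le_of Y _ _ (mul_nonneg (auxN_nonneg Y A) (auxN_nonneg Y B)) fun x => ?_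
  rw [aux_seq_comp, mul_assoc]
  exact (auxN_spec Y A hA _).trans
    (mul_le_mul_of_nonneg_left (auxN_spec Y B hB x) (auxN_nonneg Y A))

theorem auxN_sum {ι : Type*} (J : Finset ι) (A : ι → (X₀ →L[ℂ] X₀))
    (hA : ∀ i ∈ J, ∀ y ∈ Y, seqOp (A i) y ∈ Y) :
    auxN Y (∑ i ∈ J, A i) ≤ ∑ i ∈ J, auxN Y (A i) := by
  refine auxN_le_of Y _ _ (Finset.sum_nonneg fun i _ => auxN_nonneg Y _) fun x => ?_
  rw [aux_seq_sum, Finset.sum_mul]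
  exact (aux_infDist_sum Y _ _).trans (Finset.sum_le_sum fun i hi => auxN_spec Y _ (hA i hi) x)

end aux4

section aux5
variable (M : MRSetting X X₀) (L : X₀ →L[ℂ] X)

theorem aux_S_small (n : ℕ) :
    Tendsto (fun h => (M.Bop L)^[n + 1] M.T h) (𝓝[>] 0) (𝓝 0) := by
  rw [Function.iterate_succ_apply']
  exact aux_B_small M L (aux_iter_sc M L M.T_cont n)

theorem aux_S_left (n : ℕ) (t : ℝ) (ht : 0 ≤ t) :
    Tendsto (fun h => (M.Bop L)^[n] M.T (h + t) - (M.T h).comp ((M.Bop L)^[n] M.T t))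
      (𝓝[>] 0) (𝓝 0) := by
  have h1 : Tendsto (fun h => ∑ i ∈ Finset.range n,
      ((M.Bop L)^[i + 1] M.T h).comp ((M.Bop L)^[n - (i + 1)] M.T t)) (𝓝[>] 0) (𝓝 0) := by
    exact gen_sum _ fun i _ => gen_comp_left _ (aux_S_small M L i)
  refine h1.congr' ?_
  filter_upwards [self_mem_nhdsWithin] with h hh
  have hh : 0 < h := hh
  rw [aux_S_comp M L n h t hh.le ht, Finset.Nat.sum_antidiagonal_eq_sum_range_succ
    (fun i j => ((M.Bop L)^[i] M.T h).comp ((M.Bop L)^[j] M.T t)), Finset.sum_range_succ']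
  simp

theorem aux_S_right (n : ℕ) (t : ℝ) (ht : 0 ≤ t) :
    Tendsto (fun h => (M.Bop L)^[n] M.T (h + t) - ((M.Bop L)^[n] M.T t).comp (M.T h))
      (𝓝[>] 0) (𝓝 0) := by
  have h1 : Tendsto (fun h => ∑ i ∈ Finset.range n,
      ((M.Bop L)^[n - (i + 1)] M.T t).comp ((M.Bop L)^[i + 1] M.T h)) (𝓝[>] 0) (𝓝 0) := by
    exact gen_sum _ fun i _ => gen_comp_right _ (aux_S_small M L i)
  refine h1.congr' ?_
  filter_upwards [self_mem_nhdsWithin] with h hh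
  have hh : 0 < h := hh
  rw [add_comm h t, aux_S_comp M L n t h ht hh.le, ← Finset.Nat.sum_antidiagonal_swap,
    Finset.Nat.sum_antidiagonal_eq_sum_range_succ_mk, Finset.sum_range_succ']
  simp

theorem aux_S_pres (n : ℕ) (t : ℝ) (ht : 0 ≤ t) (x : BoundedContinuousFunction ℕ X₀)
    (hx : x ∈ critSub M.T) : seqOp ((M.Bop L)^[n] M.T t) x ∈ critSub M.T := by
  have hx' : Tendsto (fun h => seqOp (M.T h) x) (𝓝[>] 0) (𝓝 x) := hx
  change Tendsto (fun h => seqOp (M.T h) (seqOp ((M.Bop L)^[n] M.T t) x)) (𝓝[>] 0)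
    (𝓝 (seqOp ((M.Bop L)^[n] M.T t) x))
  have h1 := aux_seq_tendsto ((aux_S_right M L n t ht).sub (aux_S_left M L n t ht)) x
  have h2 := ((seqOp ((M.Bop L)^[n] M.T t)).continuous.tendsto x).comp hx'
  have h3 := h1.add h2
  rw [sub_zero, aux_seq_zero, zero_add] at h3
  refine h3.congr fun h => ?_
  simp only [Function.comp, aux_seq_sub, aux_seq_comp]
  abel

theorem aux_crit_eq (R : ℝ → (X₀ →L[ℂ] X₀))
    (hRsc : ∀ x : X₀, ContinuousOn (fun t => R t x) (Ici 0))
    (hRfix : ∀ t ∈ Ici (0:ℝ), R t = M.T t + M.Bop L R t) : critSub R = critSub M.T := by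
  ext x
  change Tendsto (fun t => seqOp (R t) x) (𝓝[>] 0) (𝓝 x) ↔
    Tendsto (fun t => seqOp (M.T t) x) (𝓝[>] 0) (𝓝 x)
  have hB := aux_seq_tendsto (aux_B_small M L hRsc) x
  rw [aux_seq_zero] at hB
  have hev : ∀ᶠ t in 𝓝[>] (0:ℝ), seqOp (R t) x = seqOp (M.T t) x + seqOp (M.Bop L R t) x := by
    filter_upwards [self_mem_nhdsWithin] with t ht
    rw [← aux_seq_add, ← hRfix t (mem_Ici.2 (le_of_lt ht))]
  constructor
  · intro h
    have := h.sub hB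
    rw [sub_zero] at this
    refine this.congr' ?_
    filter_upwards [hev] with t ht
    rw [ht]; abel
  · intro h
    have := h.add hB
    rw [add_zero] at this
    refine this.congr' ?_
    filter_upwards [hev] with t ht
    rw [ht]

theorem aux_sg_pres (W : ℝ → (X₀ →L[ℂ] X₀))
    (hW : ∀ t s, 0 ≤ t → 0 ≤ s → W (t + s) = (W t).comp (W s)) (t : ℝ) (ht : 0 ≤ t)
    (x : BoundedContinuousFunction ℕ X₀) (hx : x ∈ critSub W) : seqOp (W t) x ∈ critSub W := by
  have hx' : Tendsto (fun h => seqOp (W h) x) (𝓝[>] 0) (𝓝 x) := hx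
  change Tendsto (fun h => seqOp (W h) (seqOp (W t) x)) (𝓝[>] 0) (𝓝 (seqOp (W t) x))
  refine (((seqOp (W t)).continuous.tendsto x).comp hx').congr' ?_
  filter_upwards [self_mem_nhdsWithin] with h hh
  have hh : 0 < h := hh
  simp only [Function.comp]
  rw [← aux_seq_comp, ← aux_seq_comp, ← hW t h ht hh.le, ← hW h t hh.le ht, add_comm]

theorem aux_Rk_mem (R : ℝ → (X₀ →L[ℂ] X₀))
    (hRsc : ∀ x : X₀, ContinuousOn (fun t => R t x) (Ici 0))
    (hRfix : ∀ t ∈ Ici (0:ℝ), R t = M.T t + M.Bop L R t) (k : ℕ) (t : ℝ) (ht : 0 < t)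
    (hc : ContinuousAt ((M.Bop L)^[k] R) t) (x : BoundedContinuousFunction ℕ X₀) :
    seqOp ((M.Bop L)^[k] R t) x ∈ critSub M.T := by
  have h1 : Tendsto (fun h => ∑ j ∈ Finset.range k, ((M.Bop L)^[j] M.T (h + t) -
      (M.T h).comp ((M.Bop L)^[j] M.T t))) (𝓝[>] 0) (𝓝 (∑ j ∈ Finset.range k, 0)) :=
    tendsto_finsetSum _ fun j _ => aux_S_left M L j t ht.le
  rw [Finset.sum_const_zero] at h1
  have h2 : Tendsto (fun h => (M.Bop L R h).comp (R t)) (𝓝[>] 0) (𝓝 0) := by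
    exact gen_comp_left _ (aux_B_small M L hRsc)
  have h3 : Tendsto (fun h => (M.Bop L)^[k] R (h + t)) (𝓝[>] 0) (𝓝 ((M.Bop L)^[k] R t)) := by
    have hs : Tendsto (fun h : ℝ => h + t) (𝓝[>] 0) (𝓝 t) := by
      have : Tendsto (fun h : ℝ => h + t) (𝓝 0) (𝓝 (0 + t)) :=
        (continuous_id.add continuous_const).tendsto 0
      rw [zero_add] at this
      exact this.mono_left nhdsWithin_le_nhds
    exact hc.tendsto.comp hs
  have h4 := (h3.sub h2).add h1
  rw [sub_zero, add_zero] at h4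
  have h5 : Tendsto (fun h => (M.T h).comp ((M.Bop L)^[k] R t)) (𝓝[>] 0)
      (𝓝 ((M.Bop L)^[k] R t)) := by
    refine h4.congr' ?_
    filter_upwards [self_mem_nhdsWithin] with h hh
    have hh : 0 < h := hh
    have e1 := aux_R_iter M L R hRsc hRfix k (h + t) (by linarith)
    have e2 := aux_R_iter M L R hRsc hRfix k t ht.le
    rw [e1, e2, aux_R_add M L R hRsc hRfix h t hh.le ht.le, ContinuousLinearMap.comp_sub,
      hRfix h hh.le, ContinuousLinearMap.add_comp, Finset.sum_sub_distrib,
      ContinuousLinearMap.comp_finsetSum]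
    abel
  refine (aux_seq_tendsto h5 x).congr fun h => ?_
  rw [aux_seq_comp]

end aux5

theorem aux_part_a (M : MRSetting X X₀) (L : X₀ →L[ℂ] X)
    (R : ℝ → (X₀ →L[ℂ] X₀))
    (hRsc : ∀ x : X₀, ContinuousOn (fun t => R t x) (Ici 0))
    (hRfix : ∀ t ∈ Ici (0:ℝ), R t = M.T t + M.Bop L R t) (k : ℕ) (ts : ℕ → ℝ) :
    (∀ n, 0 < ts n) → Tendsto ts atTop atTop →
      (∀ n, IsCompactOperator ⇑((M.Bop L)^[k] R (ts n))) →
      omegaEss R ≤ omegaEss M.T := by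
  have hcs : CompleteSpace X₀ := M.closed.completeSpace_coe
  have hsc := fun j => aux_iter_sc M L (U := M.T) M.T_cont j
  have hRadd := aux_R_add M L R hRsc hRfix
  intro hts hlim hcpt
  refine aux_sInf _ _ ?_
  rintro w' ⟨C, _, hC⟩ w hw
  refine aux_core
    (fun n t => auxE ((M.Bop L)^[n] M.T t))
    (fun t => auxE (R t))
    (fun _ _ => auxE_nonneg _) (fun _ => auxE_nonneg _) ?_ ?_ ?_ ?_
    k ts hts hlim ?_ C w w' hw hC
  · intro n τ
    obtain ⟨K, _, hK⟩ := aux_bdd _ (hsc n) τ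
    exact ⟨K, fun t ht => (auxE_le _).trans (hK t ht)⟩
  · intro τ
    obtain ⟨K, _, hK⟩ := aux_bdd _ hRsc τ
    exact ⟨K, fun t ht => (auxE_le _).trans (hK t ht)⟩
  · intro n t s ht hs
    rw [aux_S_comp M L n t s ht hs]
    exact (auxE_sum _ _).trans (Finset.sum_le_sum fun p _ => auxE_comp _ _)
  · intro t s ht hs
    rw [hRadd t s ht hs]
    exact auxE_comp _ _
  · intro n
    have e := aux_R_iter M L R hRsc hRfix k (ts n) (hts n).le
    have h0 := auxE_zero _ (hcpt n)
    rw [eq_sub_iff_add_eq] at e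
    rw [← e]
    refine (auxE_add _ _).trans ?_
    rw [h0, zero_add]
    exact auxE_sum _ _

theorem aux_part_b (M : MRSetting X X₀) (L : X₀ →L[ℂ] X)
    (R : ℝ → (X₀ →L[ℂ] X₀))
    (hRsc : ∀ x : X₀, ContinuousOn (fun t => R t x) (Ici 0))
    (hRfix : ∀ t ∈ Ici (0:ℝ), R t = M.T t + M.Bop L R t) (k : ℕ) (ts : ℕ → ℝ) :
    (∀ n, 0 < ts n) → Tendsto ts atTop atTop →
      (∀ n, ContinuousAt ((M.Bop L)^[k] R) (ts n)) →
      critSub R = critSub M.T ∧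
      (∀ t : ℝ, 0 ≤ t → ∀ x ∈ critSub M.T, seqOp (M.T t) x ∈ critSub M.T) ∧
      (∀ t : ℝ, 0 ≤ t → ∀ x ∈ critSub M.T, seqOp (R t) x ∈ critSub M.T) ∧
      omegaCrit R ≤ omegaCrit M.T := by
  have hcs : CompleteSpace X₀ := M.closed.completeSpace_coe
  have hsc := fun j => aux_iter_sc M L (U := M.T) M.T_cont j
  have hRadd := aux_R_add M L R hRsc hRfix
  intro hts hlim hcont
  have heq := aux_crit_eq M L R hRsc hRfix
  have hTp : ∀ t : ℝ, 0 ≤ t → ∀ x ∈ critSub M.T, seqOp (M.T t) x ∈ critSub M.T :=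
    fun t ht x hx => aux_sg_pres M.T M.T_add t ht x hx
  have hRp : ∀ t : ℝ, 0 ≤ t → ∀ x ∈ critSub M.T, seqOp (R t) x ∈ critSub M.T := by
    intro t ht x hx
    rw [← heq] at hx ⊢
    exact aux_sg_pres R hRadd t ht x hx
  have hSp := fun n t ht => aux_S_pres M L n t ht
  refine ⟨heq, hTp, hRp, ?_⟩
  unfold omegaCrit
  rw [heq]
  refine aux_sInf _ _ ?_
  rintro w' ⟨C, hC0, hC⟩ w hw
  obtain ⟨C', hC'0, hC'⟩ := aux_core
    (fun n t => auxN (critSub M.T) ((M.Bop L)^[n] M.T t))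
    (fun t => auxN (critSub M.T) (R t))
    (fun _ _ => auxN_nonneg _ _) (fun _ => auxN_nonneg _ _) (by
      intro n τ
      obtain ⟨K, _, hK⟩ := aux_bdd _ (hsc n) τ
      exact ⟨K, fun t ht => (auxN_le_norm _ _ (hSp n t ht.1)).trans (hK t ht)⟩) (by
      intro τ
      obtain ⟨K, _, hK⟩ := aux_bdd _ hRsc τ
      exact ⟨K, fun t ht => (auxN_le_norm _ _ (hRp t ht.1)).trans (hK t ht)⟩) (by
      intro n t s ht hs
      rw [aux_S_comp M L n t s ht hs]
      refine (auxN_sum _ _ _ ?_).trans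
        (Finset.sum_le_sum fun p _ => auxN_comp _ _ _ (hSp _ t ht) (hSp _ s hs))
      intro p _ y hy
      rw [aux_seq_comp]
      exact hSp _ t ht _ (hSp _ s hs y hy)) (by
      intro t s ht hs
      rw [hRadd t s ht hs]
      exact auxN_comp _ _ _ (hRp t ht) (hRp s hs))
    k ts hts hlim (by
      intro n
      have e := aux_R_iter M L R hRsc hRfix k (ts n) (hts n).le
      rw [eq_sub_iff_add_eq] at e
      refine auxN_le_of _ _ _ (Finset.sum_nonneg fun i _ => auxN_nonneg _ _) fun x => ?_
      rw [← e, aux_seq_add]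
      refine (aux_infDist_add _ _ _).trans ?_
      rw [Metric.infDist_zero_of_mem
        (aux_Rk_mem M L R hRsc hRfix k (ts n) (hts n) (hcont n) x), zero_add, aux_seq_sum,
        Finset.sum_mul]
      exact (aux_infDist_sum _ _ _).trans
        (Finset.sum_le_sum fun j _ => auxN_spec _ _ (hSp j _ (hts n).le) x))
    C w w' hw (by
      intro t ht
      exact auxN_le_of _ _ _ (mul_nonneg hC0 (Real.exp_pos _).le) (hC t ht))
  refine ⟨C', hC'0, fun t ht x => ?_⟩
  exact (auxN_spec _ _ (hRp t ht) x).trans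
    (mul_le_mul_of_nonneg_right (hC' t ht) Metric.infDist_nonneg)


/-- perturbation of the essential and critical growth bounds via regularity of
`Rₖ` along a sequence `tₙ → ∞`. -/
theorem growth_bound_along_sequence (M : MRSetting X X₀) (L : X₀ →L[ℂ] X)
    (R : ℝ → (X₀ →L[ℂ] X₀))
    (hRsc : ∀ x : X₀, ContinuousOn (fun t => R t x) (Ici 0))
    (hRfix : ∀ t ∈ Ici (0:ℝ), R t = M.T t + M.Bop L R t) :
    -- (a)
    (∀ (k : ℕ) (ts : ℕ → ℝ), (∀ n, 0 < ts n) → Tendsto ts atTop atTop →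
      (∀ n, IsCompactOperator ⇑((M.Bop L)^[k] R (ts n))) →
      omegaEss R ≤ omegaEss M.T) ∧
    -- (b)
    (∀ (k : ℕ) (ts : ℕ → ℝ), (∀ n, 0 < ts n) → Tendsto ts atTop atTop →
      (∀ n, ContinuousAt ((M.Bop L)^[k] R) (ts n)) →
      critSub R = critSub M.T ∧
      (∀ t : ℝ, 0 ≤ t → ∀ x ∈ critSub M.T, seqOp (M.T t) x ∈ critSub M.T) ∧
      (∀ t : ℝ, 0 ≤ t → ∀ x ∈ critSub M.T, seqOp (R t) x ∈ critSub M.T) ∧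
      omegaCrit R ≤ omegaCrit M.T) := by

  exact ⟨fun k ts => aux_part_a M L R hRsc hRfix k ts, fun k ts => aux_part_b M L R hRsc hRfix k ts⟩

end
end
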